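/- arXiv:2308.06048 — 10 statements merged into one kernel-verified Lean document; each statement's English description precedes it below -/
import Mathlib

section
/- Let 0 < σ < 1/2 and let ξ₁ ≤ ξ₂ be real numbers. Then there is a constant C(σ) > 0 depending only on σ such that (∫_ℝ |k|^{2σ} |𝓕(E₁(·; ξ₁, ξ₂))(k)|² dk)^{1/2} ≤ C(σ) (ξ₂ − ξ₁). -/
open MeasureTheory

/-- The Fourier transform `𝓕(f)(k) = (1/(2π)) ∫_ℝ e^{-ikξ} f(ξ) dξ`. -/
noncomputable def FT (f : ℝ → ℂ) (k : ℝ) : ℂ :=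
  (1 / (2 * Real.pi)) * ∫ ξ : ℝ, Complex.exp (-Complex.I * k * ξ) * f ξ

/-- `E₁(ξ; ξ₁, ξ₂) = e^{ξ-ξ₁} - e^{ξ-ξ₂}` for `ξ ≤ ξ₁`, and `0` otherwise. -/
noncomputable def E1 (ξ₁ ξ₂ ξ : ℝ) : ℝ :=
  if ξ ≤ ξ₁ then Real.exp (ξ - ξ₁) - Real.exp (ξ - ξ₂) else 0

lemma FT_E1_norm_sq (a b k : ℝ) (hab : a ≤ b) :
    ‖FT (fun ξ => (E1 a b ξ : ℂ)) k‖ ^ 2 ≤ (b - a) ^ 2 * (1 + k ^ 2)⁻¹ := by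
  have h1 : (fun ξ : ℝ => Complex.exp (-Complex.I * k * ξ) * (E1 a b ξ : ℂ)) =
      (Set.Iic a).indicator (fun ξ : ℝ => ((Real.exp (-a) - Real.exp (-b) : ℝ) : ℂ) *
        Complex.exp ((1 - Complex.I * k) * ξ)) := by
    funext ξ
    by_cases h : ξ ≤ a
    · rw [Set.indicator_of_mem (by exact h)]
      simp only [E1, h, if_true]
      push_cast
      rw [mul_sub, sub_mul, ← Complex.exp_add, ← Complex.exp_add, ← Complex.exp_add,
        ← Complex.exp_add]
      congr 2 <;> ring
    · rw [Set.indicator_of_notMem (by exact h)]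
      simp [E1, h]
  have hre : (1 - Complex.I * k : ℂ).re = 1 := by simp
  have hn : ‖(1 - Complex.I * k : ℂ)‖ ^ 2 = 1 + k ^ 2 := by
    rw [← Complex.normSq_eq_norm_sq, Complex.normSq_apply]
    simp
    ring
  have h2 : ‖Complex.exp ((1 - Complex.I * k) * a)‖ = Real.exp a := by
    rw [Complex.norm_exp]; simp
  have hpi : (1 / (2 * Real.pi)) ≤ 1 := by
    rw [div_le_one (by positivity)]
    linarith [Real.pi_gt_three]
  have hpi0 : 0 ≤ (1 / (2 * Real.pi)) := by positivity
  have h3 : (Real.exp (-a) - Real.exp (-b)) * Real.exp a = 1 - Real.exp (a - b) := by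
    rw [sub_mul, ← Real.exp_add, ← Real.exp_add]
    simp [show -b + a = a - b by ring]
  have h4 : 0 ≤ 1 - Real.exp (a - b) := by
    have : Real.exp (a - b) ≤ 1 := Real.exp_le_one_iff.2 (by linarith)
    linarith
  have h5 : 1 - Real.exp (a - b) ≤ b - a := by
    linarith [Real.add_one_le_exp (a - b)]
  have key : ‖FT (fun ξ => (E1 a b ξ : ℂ)) k‖ ^ 2 =
      (1 / (2 * Real.pi)) ^ 2 * ((1 - Real.exp (a - b)) ^ 2 * (1 + k ^ 2)⁻¹) := by
    unfold FT
    rw [h1, integral_indicator measurableSet_Iic, integral_const_mul,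
      integral_exp_mul_complex_Iic (by rw [hre]; norm_num), ← h3]
    simp only [norm_mul, norm_div, mul_pow, div_pow, h2, hn, Complex.norm_real]
    simp
    ring
  rw [key]
  have h6 : (1 / (2 * Real.pi)) ^ 2 ≤ 1 := pow_le_one₀ hpi0 hpi
  have h7 : (1 - Real.exp (a - b)) ^ 2 ≤ (b - a) ^ 2 := pow_le_pow_left₀ h4 h5 2
  calc _ ≤ 1 * ((b - a) ^ 2 * (1 + k ^ 2)⁻¹) := by gcongr
    _ = _ := one_mul _

/-- For `0 < σ < 1/2` and `ξ₁ ≤ ξ₂`: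
`(∫_ℝ |k|^{2σ} |𝓕(E₁(·;ξ₁,ξ₂))(k)|² dk)^{1/2} ≤ C(σ) (ξ₂ - ξ₁)`,
the left-hand side being a lower Lebesgue integral in `ℝ≥0∞`. -/
theorem E1_FT_bound (σ : ℝ) (hσ₁ : 0 < σ) (hσ₂ : σ < 1 / 2) :
    ∃ C : ℝ, 0 < C ∧ ∀ ξ₁ ξ₂ : ℝ, ξ₁ ≤ ξ₂ →
      (∫⁻ k : ℝ,
          ENNReal.ofReal (|k| ^ (2 * σ) * ‖FT (fun ξ => (E1 ξ₁ ξ₂ ξ : ℂ)) k‖ ^ 2)) ^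
          ((1 : ℝ) / 2) ≤
        ENNReal.ofReal (C * (ξ₂ - ξ₁)) := by
  have hint : Integrable (fun k : ℝ => (1 + ‖k‖ ^ 2) ^ (-(2 - 2 * σ) / 2)) :=
    integrable_rpow_neg_one_add_norm_sq (by simp; linarith)
  set J := ∫ k : ℝ, (1 + ‖k‖ ^ 2) ^ (-(2 - 2 * σ) / 2) with hJ
  have hJ0 : 0 ≤ J := integral_nonneg fun k => by positivity
  refine ⟨Real.sqrt J + 1, by positivity, fun a b hab => ?_⟩
  have hd : 0 ≤ b - a := by linarith
  have hle : (∫⁻ k : ℝ, ENNReal.ofReal (|k| ^ (2 * σ) * ‖FT (fun ξ => (E1 a b ξ : ℂ)) k‖ ^ 2))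
      ≤ ENNReal.ofReal ((b - a) ^ 2 * J) := by
    rw [hJ, ← integral_const_mul, ofReal_integral_eq_lintegral_ofReal (hint.const_mul _)
      (Filter.Eventually.of_forall fun k => by positivity)]
    refine lintegral_mono fun k => ENNReal.ofReal_le_ofReal ?_
    have e1 : |k| ^ (2 * σ) ≤ (1 + k ^ 2) ^ σ := by
      rw [Real.rpow_mul (abs_nonneg k)]
      refine Real.rpow_le_rpow (by positivity) ?_ hσ₁.le
      rw [Real.rpow_two, sq_abs]
      linarith
    have e2 : (1 + ‖k‖ ^ 2) ^ (-(2 - 2 * σ) / 2) = (1 + k ^ 2) ^ σ * (1 + k ^ 2)⁻¹ := by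
      rw [Real.norm_eq_abs, sq_abs, ← Real.rpow_neg_one, ← Real.rpow_add (by positivity)]
      congr 1
      ring
    rw [e2]
    calc _ ≤ (1 + k ^ 2) ^ σ * ((b - a) ^ 2 * (1 + k ^ 2)⁻¹) := by
          gcongr
          exact FT_E1_norm_sq a b k hab
      _ = _ := by ring
  refine (ENNReal.rpow_le_rpow hle (by norm_num)).trans ?_
  rw [ENNReal.ofReal_rpow_of_nonneg (by positivity) (by norm_num)]
  refine ENNReal.ofReal_le_ofReal ?_
  rw [← Real.sqrt_eq_rpow, Real.sqrt_mul (by positivity), Real.sqrt_sq hd]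
  nlinarith
end

section
/- Let 0 < σ < 1/2 and let ξ₁ ≤ ξ₂ be real numbers with ξ₂ − ξ₁ ≤ 1. Then there is a constant C(σ) > 0 depending only on σ such that (∫_ℝ |k|^{2σ} |𝓕(E₂(·; ξ₁, ξ₂))(k)|² dk)^{1/2} ≤ C(σ) (ξ₂ − ξ₁)^{1/2 − σ}. -/
open MeasureTheory

/-- `E₂(ξ; ξ₁, ξ₂) = e^{ξ-ξ₂}` for `ξ₁ ≤ ξ ≤ ξ₂`, and `0` otherwise. -/
noncomputable def E2 (ξ₁ ξ₂ ξ : ℝ) : ℝ :=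
  if ξ₁ ≤ ξ ∧ ξ ≤ ξ₂ then Real.exp (ξ - ξ₂) else 0

lemma E2_int_eq (a b k : ℝ) (hab : a ≤ b) :
    ∫ ξ : ℝ, Complex.exp (-Complex.I * k * ξ) * ((E2 a b ξ : ℝ) : ℂ) =
      ∫ ξ in a..b, Complex.exp (-b) * Complex.exp ((1 - Complex.I * k) * ξ) := by
  rw [intervalIntegral.integral_of_le hab, ← integral_Icc_eq_integral_Ioc,
    ← integral_indicator measurableSet_Icc]
  congr 1
  ext ξ
  by_cases h : ξ ∈ Set.Icc a b
  · have h' : a ≤ ξ ∧ ξ ≤ b := h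
    rw [Set.indicator_of_mem h, E2, if_pos h', Complex.ofReal_exp, ← Complex.exp_add,
      ← Complex.exp_add]
    congr 1
    push_cast
    ring
  · have h' : ¬ (a ≤ ξ ∧ ξ ≤ b) := h
    rw [Set.indicator_of_notMem h, E2, if_neg h']
    simp

lemma E2_norm_exp (b k ξ : ℝ) :
    ‖Complex.exp (-b) * Complex.exp ((1 - Complex.I * k) * ξ)‖ = Real.exp (ξ - b) := by
  rw [← Complex.exp_add, Complex.norm_exp]
  congr 1
  simp
  ring

lemma E2_int_le (a b k : ℝ) (hab : a ≤ b) :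
    ‖∫ ξ : ℝ, Complex.exp (-Complex.I * k * ξ) * ((E2 a b ξ : ℝ) : ℂ)‖ ≤ b - a := by
  rw [E2_int_eq a b k hab]
  have := intervalIntegral.norm_integral_le_of_norm_le_const (a := a) (b := b) (C := 1)
    (f := fun ξ : ℝ => Complex.exp (-b) * Complex.exp ((1 - Complex.I * k) * ξ)) (by
      intro x hx
      rw [Set.uIoc_of_le hab] at hx
      rw [E2_norm_exp]
      exact Real.exp_le_one_iff.2 (by linarith [hx.2]))
  rwa [one_mul, abs_of_nonneg (by linarith)] at this

lemma E2_int_mul_le (a b k : ℝ) (hab : a ≤ b) :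
    ‖∫ ξ : ℝ, Complex.exp (-Complex.I * k * ξ) * ((E2 a b ξ : ℝ) : ℂ)‖ * |k| ≤ 2 := by
  rw [E2_int_eq a b k hab]
  have hc : (1 - Complex.I * k : ℂ) ≠ 0 := by
    intro h
    have := congrArg Complex.re h
    simp at this
  have hk : |k| ≤ ‖(1 - Complex.I * k : ℂ)‖ := by
    have := Complex.abs_im_le_norm (1 - Complex.I * k : ℂ)
    simpa using this
  have hpos : 0 < ‖(1 - Complex.I * k : ℂ)‖ := norm_pos_iff.2 hc
  rw [intervalIntegral.integral_const_mul, integral_exp_mul_complex hc, ← mul_div_assoc,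
    norm_div, mul_sub]
  have h2 : ‖Complex.exp (-b) * Complex.exp ((1 - Complex.I * k) * b) -
      Complex.exp (-b) * Complex.exp ((1 - Complex.I * k) * a)‖ ≤ 2 := by
    refine (norm_sub_le _ _).trans ?_
    rw [E2_norm_exp, E2_norm_exp]
    have h1 : Real.exp (a - b) ≤ 1 := Real.exp_le_one_iff.2 (by linarith)
    have h0 : Real.exp (b - b) = 1 := by simp
    linarith
  rw [div_mul_eq_mul_div, div_le_iff₀ hpos]
  exact mul_le_mul h2 hk (abs_nonneg _) (by norm_num)

lemma E2_FT_le (a b k : ℝ) (hab : a ≤ b) :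
    ‖FT (fun ξ => (E2 a b ξ : ℂ)) k‖ * (1 + |(b - a) * k|) ≤ 3 * (b - a) := by
  have hd : 0 ≤ b - a := by linarith
  have h1 := E2_int_le a b k hab
  have h2 := E2_int_mul_le a b k hab
  have h3 : ‖FT (fun ξ => (E2 a b ξ : ℂ)) k‖ ≤
      ‖∫ ξ : ℝ, Complex.exp (-Complex.I * k * ξ) * ((E2 a b ξ : ℝ) : ℂ)‖ := by
    rw [FT, norm_mul]
    refine mul_le_of_le_one_left (norm_nonneg _) ?_
    have hp := Real.pi_gt_three
    have : (1 / (2 * Real.pi) : ℂ) = ((1 / (2 * Real.pi) : ℝ) : ℂ) := by push_cast; rfl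
    rw [this, Complex.norm_real, Real.norm_of_nonneg (by positivity),
      div_le_one (by positivity)]
    linarith
  generalize ‖FT (fun ξ => (E2 a b ξ : ℂ)) k‖ = F at *
  generalize ‖∫ ξ : ℝ, Complex.exp (-Complex.I * k * ξ) * ((E2 a b ξ : ℝ) : ℂ)‖ = J at *
  rw [abs_mul, abs_of_nonneg hd]
  have h4 : F * |k| ≤ 2 := (mul_le_mul_of_nonneg_right h3 (abs_nonneg k)).trans h2
  nlinarith [mul_le_mul_of_nonneg_left h4 hd]

lemma E2_pointwise (σ : ℝ) (hσ₁ : 0 < σ) (a b k : ℝ) (hab : a < b) :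
    |k| ^ (2 * σ) * ‖FT (fun ξ => (E2 a b ξ : ℂ)) k‖ ^ 2 ≤
      9 * (b - a) ^ (2 - 2 * σ) * (1 + ‖(b - a) * k‖) ^ (-(2 - 2 * σ)) := by
  have hd : 0 < b - a := by linarith
  have h := E2_FT_le a b k hab.le
  rw [Real.norm_eq_abs]
  have hF := norm_nonneg (FT (fun ξ => (E2 a b ξ : ℂ)) k)
  generalize ‖FT (fun ξ => (E2 a b ξ : ℂ)) k‖ = F at *
  have hu : |(b - a) * k| = (b - a) * |k| := by rw [abs_mul, abs_of_pos hd]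
  rw [hu] at h ⊢
  generalize b - a = d at *
  have hk := abs_nonneg k
  generalize |k| = q at *
  have hw : 0 < 1 + d * q := by positivity
  have e1 : q ^ (2 * σ) ≤ (1 + d * q) ^ (2 * σ) * d ^ (-(2 * σ)) := by
    rw [Real.rpow_neg hd.le, ← div_eq_mul_inv, le_div_iff₀ (by positivity),
      ← Real.mul_rpow hk hd.le]
    exact Real.rpow_le_rpow (by positivity) (by linarith) (by linarith)
  have e2 : F ^ 2 ≤ 9 * d ^ (2 : ℝ) * (1 + d * q) ^ (-2 : ℝ) := by
    rw [Real.rpow_neg hw.le, ← div_eq_mul_inv, le_div_iff₀ (by positivity), Real.rpow_two,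
      Real.rpow_two, ← mul_pow]
    calc _ ≤ (3 * d) ^ 2 := pow_le_pow_left₀ (by positivity) h 2
      _ = _ := by ring
  calc _ ≤ ((1 + d * q) ^ (2 * σ) * d ^ (-(2 * σ))) *
        (9 * d ^ (2 : ℝ) * (1 + d * q) ^ (-2 : ℝ)) := by gcongr
    _ = 9 * (d ^ (2 : ℝ) * d ^ (-(2 * σ))) *
        ((1 + d * q) ^ (-2 : ℝ) * (1 + d * q) ^ (2 * σ)) := by ring
    _ = _ := by
      rw [← Real.rpow_add hd, ← Real.rpow_add hw]
      congr 2
      ring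

/-- For `0 < σ < 1/2` and `ξ₁ ≤ ξ₂` with `ξ₂ - ξ₁ ≤ 1`:
`(∫_ℝ |k|^{2σ} |𝓕(E₂(·;ξ₁,ξ₂))(k)|² dk)^{1/2} ≤ C(σ) (ξ₂ - ξ₁)^{1/2-σ}`,
the left-hand side being a lower Lebesgue integral in `ℝ≥0∞`. -/
theorem E2_FT_bound (σ : ℝ) (hσ₁ : 0 < σ) (hσ₂ : σ < 1 / 2) :
    ∃ C : ℝ, 0 < C ∧ ∀ ξ₁ ξ₂ : ℝ, ξ₁ ≤ ξ₂ → ξ₂ - ξ₁ ≤ 1 →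
      (∫⁻ k : ℝ,
          ENNReal.ofReal (|k| ^ (2 * σ) * ‖FT (fun ξ => (E2 ξ₁ ξ₂ ξ : ℂ)) k‖ ^ 2)) ^
          ((1 : ℝ) / 2) ≤
        ENNReal.ofReal (C * (ξ₂ - ξ₁) ^ (1 / 2 - σ)) := by
  have hr : (Module.finrank ℝ ℝ : ℝ) < 2 - 2 * σ := by simp; linarith
  have hint := integrable_one_add_norm (E := ℝ) (μ := volume) hr
  set g : ℝ → ℝ := fun x => (1 + ‖x‖) ^ (-(2 - 2 * σ)) with hg
  have hg0 : ∀ x, 0 ≤ g x := fun x => by simp only [hg]; positivity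
  set K : ℝ := ∫ x, g x with hK
  have hK0 : 0 ≤ K := integral_nonneg hg0
  refine ⟨(9 * K + 1) ^ ((1 : ℝ) / 2), by positivity, ?_⟩
  intro a b hab _
  rcases hab.eq_or_lt with rfl | hlt
  · have hz : ∀ k, ‖FT (fun ξ => (E2 a a ξ : ℂ)) k‖ = 0 := by
      intro k
      have := E2_FT_le a a k le_rfl
      simp only [sub_self, zero_mul, abs_zero, add_zero, mul_one, mul_zero] at this
      exact le_antisymm this (norm_nonneg _)
    simp [hz]
  have hd : 0 < b - a := by linarith
  have hle : (∫⁻ k : ℝ,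
      ENNReal.ofReal (|k| ^ (2 * σ) * ‖FT (fun ξ => (E2 a b ξ : ℂ)) k‖ ^ 2)) ≤
      ENNReal.ofReal ((9 * K + 1) * (b - a) ^ (1 - 2 * σ)) := by
    calc _ ≤ ∫⁻ k : ℝ, ENNReal.ofReal (9 * (b - a) ^ (2 - 2 * σ) * g ((b - a) * k)) :=
          lintegral_mono fun k => ENNReal.ofReal_le_ofReal (E2_pointwise σ hσ₁ a b k hlt)
      _ = ENNReal.ofReal (∫ k : ℝ, 9 * (b - a) ^ (2 - 2 * σ) * g ((b - a) * k)) := by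
          rw [ofReal_integral_eq_lintegral_ofReal]
          · exact (hint.comp_mul_left' hd.ne').const_mul _
          · exact Filter.Eventually.of_forall fun k => mul_nonneg (by positivity) (hg0 _)
      _ ≤ _ := by
          apply ENNReal.ofReal_le_ofReal
          rw [integral_const_mul, Measure.integral_comp_mul_left, ← hK, smul_eq_mul,
            abs_of_pos (inv_pos.2 hd)]
          have e : (b - a) ^ (2 - 2 * σ) = (b - a) ^ (1 - 2 * σ) * (b - a) := by
            rw [← Real.rpow_add_one hd.ne']
            congr 1
            ring
          have hp : 0 < (b - a) ^ (1 - 2 * σ) := by positivity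
          rw [e]
          have : 9 * ((b - a) ^ (1 - 2 * σ) * (b - a)) * ((b - a)⁻¹ * K) =
              9 * K * (b - a) ^ (1 - 2 * σ) := by
            field_simp
          rw [this]
          nlinarith
  refine (ENNReal.rpow_le_rpow hle (by norm_num)).trans (le_of_eq ?_)
  rw [ENNReal.ofReal_rpow_of_nonneg (by positivity) (by norm_num),
    Real.mul_rpow (by positivity) (by positivity), ← Real.rpow_mul hd.le]
  congr 3
  ring
end

section
/- Let 0 < σ < 1/2 and let ξ₁ ≤ ξ₂ be real numbers. Then there is a constant C(σ) > 0 depending only on σ such that ∫_{−∞}^{ξ₁} ∫_{ξ₁}^{∞} E₁(η; ξ₁, ξ₂)² / (ξ − η)^{1+2σ} dξ dη ≤ C(σ) (ξ₂ − ξ₁)². -/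
open MeasureTheory

lemma inner_bound (σ : ℝ) (hσ : 0 < σ) (a b K : ℝ) (hab : b < a) (hK : 0 ≤ K) :
    (∫⁻ ξ in Set.Ici a, ENNReal.ofReal (K / (ξ - b) ^ (1 + 2 * σ))) ≤
      ENNReal.ofReal (K * ((a - b) ^ (-(2 * σ)) / (2 * σ))) := by
  have hpos : 0 < a - b := by linarith
  have e1 : (∫⁻ ξ in Set.Ici a, ENNReal.ofReal (K / (ξ - b) ^ (1 + 2 * σ))) =
      ∫⁻ x, (Set.Ioi (a - b)).indicator
        (fun x => ENNReal.ofReal (K * x ^ (-(1 + 2 * σ)))) x := by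
    rw [← lintegral_sub_right_eq_self (fun x => (Set.Ioi (a - b)).indicator
        (fun x => ENNReal.ofReal (K * x ^ (-(1 + 2 * σ)))) x) b, setLIntegral_congr Ioi_ae_eq_Ici.symm,
      ← lintegral_indicator measurableSet_Ioi]
    refine lintegral_congr fun x => ?_
    by_cases h : a < x
    · have h2 : a - b < x - b := by linarith
      rw [Set.indicator_of_mem (by exact h), Set.indicator_of_mem (by exact h2),
        Real.rpow_neg (by linarith), div_eq_mul_inv]
    · have h2 : ¬ a - b < x - b := by intro h3; apply h; linarith
      rw [Set.indicator_of_notMem (by exact h), Set.indicator_of_notMem (by exact h2)]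
  rw [e1, lintegral_indicator measurableSet_Ioi, ← ofReal_integral_eq_lintegral_ofReal]
  · rw [integral_const_mul, integral_Ioi_rpow_of_lt (by linarith) hpos]
    apply le_of_eq
    congr 2
    have : -(1 + 2 * σ) + 1 = -(2 * σ) := by ring
    rw [this, neg_div_neg_eq]
  · exact (integrableOn_Ioi_rpow_of_lt (by linarith) hpos).const_mul K
  · filter_upwards [ae_restrict_mem measurableSet_Ioi] with x hx
    have : 0 < x := hpos.trans hx
    simp only [Pi.zero_apply]
    positivity

lemma E1_sq_le (a b x : ℝ) (hab : a ≤ b) (hx : x ≤ a) :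
    (E1 a b x) ^ 2 ≤ (b - a) ^ 2 * Real.exp (-(a - x)) := by
  have h1 : E1 a b x = Real.exp (x - a) * (1 - Real.exp (-(b - a))) := by
    rw [E1, if_pos hx, mul_sub, ← Real.exp_add]
    ring_nf
  have h2 : 0 ≤ 1 - Real.exp (-(b - a)) := by
    have := Real.exp_le_one_iff.2 (show -(b - a) ≤ 0 by linarith)
    linarith
  have h3 : 1 - Real.exp (-(b - a)) ≤ b - a := by
    have := Real.add_one_le_exp (-(b - a))
    linarith
  have h4 : Real.exp (x - a) ≤ 1 := Real.exp_le_one_iff.2 (by linarith)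
  have h5 := Real.exp_pos (x - a)
  rw [h1, mul_pow, mul_comm, neg_sub a x]
  have h6 : Real.exp (x - a) ^ 2 ≤ Real.exp (x - a) := by nlinarith
  exact mul_le_mul (pow_le_pow_left₀ h2 h3 2) h6 (by positivity) (by positivity)

/-- For `0 < σ < 1/2` and `ξ₁ ≤ ξ₂`:
`∫_{-∞}^{ξ₁} ∫_{ξ₁}^{∞} E₁(η;ξ₁,ξ₂)² / (ξ-η)^{1+2σ} dξ dη ≤ C(σ) (ξ₂-ξ₁)²`,
where `η` ranges over `(-∞, ξ₁]` and `ξ` over `[ξ₁, ∞)`. -/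
theorem E1_offdiag_bound (σ : ℝ) (hσ₁ : 0 < σ) (hσ₂ : σ < 1 / 2) :
    ∃ C : ℝ, 0 < C ∧ ∀ ξ₁ ξ₂ : ℝ, ξ₁ ≤ ξ₂ →
      (∫⁻ η in Set.Iic ξ₁, ∫⁻ ξ in Set.Ici ξ₁,
          ENNReal.ofReal ((E1 ξ₁ ξ₂ η) ^ 2 / (ξ - η) ^ (1 + 2 * σ))) ≤
        ENNReal.ofReal (C * (ξ₂ - ξ₁) ^ 2) := by
  have hs : 0 < 1 - 2 * σ := by linarith
  refine ⟨Real.Gamma (1 - 2 * σ) / (2 * σ), div_pos (Real.Gamma_pos_of_pos hs) (by linarith), ?_⟩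
  intro a b hab
  set G : ℝ → ENNReal := (Set.Ioi (0 : ℝ)).indicator (fun x => ENNReal.ofReal
    ((b - a) ^ 2 / (2 * σ) * (Real.exp (-x) * x ^ ((1 - 2 * σ) - 1)))) with hG
  calc _ = ∫⁻ η in Set.Iio a, ∫⁻ ξ in Set.Ici a,
          ENNReal.ofReal ((E1 a b η) ^ 2 / (ξ - η) ^ (1 + 2 * σ)) :=
        setLIntegral_congr Iio_ae_eq_Iic.symm
    _ ≤ ∫⁻ η in Set.Iio a, G (a - η) := by
        refine setLIntegral_mono' measurableSet_Iio fun η hη => ?_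
        have hη' : η < a := hη
        have h0 : 0 < a - η := by linarith
        refine (inner_bound σ hσ₁ a η _ hη' (sq_nonneg _)).trans ?_
        rw [hG, Set.indicator_of_mem (by exact h0)]
        apply ENNReal.ofReal_le_ofReal
        have h1 := E1_sq_le a b η hab hη'.le
        have h2 : (1 - 2 * σ) - 1 = -(2 * σ) := by ring
        rw [h2]
        calc _ ≤ ((b - a) ^ 2 * Real.exp (-(a - η))) * ((a - η) ^ (-(2 * σ)) / (2 * σ)) := by
              gcongr
          _ = _ := by ring
    _ ≤ ∫⁻ η, G (a - η) := setLIntegral_le_lintegral _ _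
    _ = ∫⁻ x, G x := lintegral_sub_left_eq_self G a
    _ = _ := by
        rw [hG, lintegral_indicator measurableSet_Ioi, ← ofReal_integral_eq_lintegral_ofReal]
        · rw [integral_const_mul, ← Real.Gamma_eq_integral hs]
          congr 1
          ring
        · exact (Real.GammaIntegral_convergent hs).const_mul _
        · filter_upwards [ae_restrict_mem measurableSet_Ioi] with x hx
          have : 0 < x := hx
          simp only [Pi.zero_apply]
          positivity
end

section
/- Let 0 < σ < 1/2 and let ξ₁ ≤ ξ₂ be real numbers. Then there is a constant C(σ) > 0 depending only on σ such that ∫_{−∞}^{ξ₁} ∫_{−∞}^{ξ₁} (E₁(ξ; ξ₁, ξ₂) − E₁(η; ξ₁, ξ₂))² / |ξ − η|^{1+2σ} dξ dη ≤ C(σ) (ξ₂ − ξ₁)². -/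
open MeasureTheory

/-- The convolution kernel dominating `min(1,t²)/|t|^{1+2σ}`. -/
noncomputable def kerF (σ : ℝ) (t : ℝ) : ℝ :=
  if t ≤ 1 then t ^ (1 - 2 * σ) else t ^ (-1 - 2 * σ)

lemma kerF_measurable (σ : ℝ) : Measurable (kerF σ) := by
  unfold kerF
  refine Measurable.ite measurableSet_Iic ?_ ?_ <;> fun_prop

lemma kerF_nonneg (σ : ℝ) {t : ℝ} (ht : 0 ≤ t) : 0 ≤ kerF σ t := by
  unfold kerF
  split_ifs <;> positivity

lemma kerF_integrableOn (σ : ℝ) (hσ₁ : 0 < σ) (hσ₂ : σ < 1 / 2) :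
    IntegrableOn (kerF σ) (Set.Ioi 0) := by
  rw [← Set.Ioc_union_Ioi_eq_Ioi (zero_le_one' ℝ)]
  refine IntegrableOn.union ?_ ?_
  · have h : IntegrableOn (fun t : ℝ => t ^ (1 - 2 * σ)) (Set.Ioc 0 1) := by
      rw [← intervalIntegrable_iff_integrableOn_Ioc_of_le zero_le_one]
      exact intervalIntegral.intervalIntegrable_rpow' (by linarith)
    refine h.congr_fun ?_ measurableSet_Ioc
    intro t ht
    simp [kerF, ht.2]
  · have h : IntegrableOn (fun t : ℝ => t ^ (-1 - 2 * σ)) (Set.Ioi 1) :=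
      integrableOn_Ioi_rpow_of_lt (by linarith) one_pos
    refine h.congr_fun ?_ measurableSet_Ioi
    intro t ht
    have : ¬ t ≤ 1 := not_le.mpr ht
    simp [kerF, this]

lemma kerF_integrable (σ : ℝ) (hσ₁ : 0 < σ) (hσ₂ : σ < 1 / 2) :
    Integrable (fun t : ℝ => kerF σ |t|) := by
  have key : IntegrableOn (kerF σ) (Set.Ioi 0) := kerF_integrableOn σ hσ₁ hσ₂
  have h1 : IntegrableOn (fun t : ℝ => kerF σ |t|) (Set.Ioi 0) :=
    key.congr_fun (fun t ht => by simp only [abs_of_pos (Set.mem_Ioi.mp ht)]) measurableSet_Ioi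
  have h2 : IntegrableOn (fun t : ℝ => kerF σ |t|) (Set.Iic 0) := by
    have h3 : IntegrableOn (fun t : ℝ => kerF σ |t|) (Set.Ici 0) :=
      Iff.mpr integrableOn_Ici_iff_integrableOn_Ioi h1
    have h4 := (Measure.measurePreserving_neg (volume : Measure ℝ)).integrableOn_comp_preimage
      (f := fun t : ℝ => kerF σ |t|) (s := Set.Ici 0) (Homeomorph.neg ℝ).measurableEmbedding
    have h5 := h4.mpr h3
    simpa [Function.comp_def] using h5
  rw [← integrableOn_univ, ← Set.Iic_union_Ioi (a := (0 : ℝ))]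
  exact h2.union h1

lemma sq_bound_aux {x y : ℝ} (hxy : x ≤ y) (hy : y ≤ 0) :
    (Real.exp y - Real.exp x) ^ 2 ≤ (Real.exp x + Real.exp y) * (min 1 (y - x)) ^ 2 := by
  have e : Real.exp x = Real.exp y * Real.exp (x - y) := by
    rw [← Real.exp_add]; ring_nf
  have h1 : Real.exp (x - y) ≤ 1 := Real.exp_le_one_iff.mpr (by linarith)
  have h2 := Real.add_one_le_exp (x - y)
  have h3 := Real.exp_pos (x - y)
  have h4 : Real.exp y ≤ 1 := Real.exp_le_one_iff.mpr hy
  have h5 := Real.exp_pos y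
  have h6 := Real.exp_pos x
  have hm : 1 - Real.exp (x - y) ≤ min 1 (y - x) := le_min (by linarith) (by linarith)
  have hsq : (1 - Real.exp (x - y)) ^ 2 ≤ (min 1 (y - x)) ^ 2 :=
    pow_le_pow_left₀ (by linarith) hm 2
  have : (Real.exp y - Real.exp x) ^ 2 = Real.exp y ^ 2 * (1 - Real.exp (x - y)) ^ 2 := by
    rw [e]; ring
  rw [this]
  apply mul_le_mul _ hsq (sq_nonneg _) (by positivity)
  nlinarith

lemma sq_bound {x y : ℝ} (hx : x ≤ 0) (hy : y ≤ 0) :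
    (Real.exp x - Real.exp y) ^ 2 ≤ (Real.exp x + Real.exp y) * (min 1 |x - y|) ^ 2 := by
  rcases le_total x y with h | h
  · rw [abs_sub_comm, abs_of_nonneg (sub_nonneg.mpr h)]
    have := sq_bound_aux h hy
    nlinarith
  · rw [abs_of_nonneg (sub_nonneg.mpr h)]
    have := sq_bound_aux h hx
    nlinarith

lemma ker_bound (σ : ℝ) {t : ℝ} (ht : 0 ≤ t) :
    (min 1 t) ^ 2 / t ^ (1 + 2 * σ) ≤ kerF σ t := by
  rcases ht.eq_or_lt with rfl | h
  · simpa using kerF_nonneg σ le_rfl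
  · unfold kerF
    split_ifs with h1
    · rw [min_eq_right h1, ← Real.rpow_natCast, ← Real.rpow_sub h]
      apply le_of_eq
      congr 1
      push_cast
      ring
    · rw [min_eq_left (not_le.mp h1).le, one_pow, one_div, ← Real.rpow_neg ht]
      apply le_of_eq
      congr 1
      ring

lemma point_bound (σ ξ₁ ξ₂ x y : ℝ) (h : ξ₁ ≤ ξ₂) (hx : x ≤ ξ₁) (hy : y ≤ ξ₁) :
    (E1 ξ₁ ξ₂ x - E1 ξ₁ ξ₂ y) ^ 2 / |x - y| ^ (1 + 2 * σ) ≤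
      (ξ₂ - ξ₁) ^ 2 * (Real.exp (x - ξ₁) * kerF σ |x - y| + Real.exp (y - ξ₁) * kerF σ |x - y|) := by
  have e : ∀ z, Real.exp (z - ξ₂) = Real.exp (z - ξ₁) * Real.exp (ξ₁ - ξ₂) := by
    intro z; rw [← Real.exp_add]; ring_nf
  have e2 : (E1 ξ₁ ξ₂ x - E1 ξ₁ ξ₂ y) ^ 2 =
      (1 - Real.exp (ξ₁ - ξ₂)) ^ 2 * (Real.exp (x - ξ₁) - Real.exp (y - ξ₁)) ^ 2 := by
    simp only [E1, hx, hy, if_true]; rw [e x, e y]; ring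
  have h1 : Real.exp (ξ₁ - ξ₂) ≤ 1 := Real.exp_le_one_iff.mpr (by linarith)
  have h2 := Real.add_one_le_exp (ξ₁ - ξ₂)
  have h3 : (1 - Real.exp (ξ₁ - ξ₂)) ^ 2 ≤ (ξ₂ - ξ₁) ^ 2 :=
    pow_le_pow_left₀ (by linarith) (by linarith) 2
  have h4 := sq_bound (sub_nonpos.mpr hx) (sub_nonpos.mpr hy)
  rw [sub_sub_sub_cancel_right] at h4
  have h5 := ker_bound σ (abs_nonneg (x - y))
  rw [e2, mul_div_assoc, ← add_mul]
  refine mul_le_mul h3 ?_ (by positivity) (by positivity)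
  calc _ ≤ (Real.exp (x - ξ₁) + Real.exp (y - ξ₁)) * (min 1 |x - y|) ^ 2
          / |x - y| ^ (1 + 2 * σ) := by gcongr
    _ = (Real.exp (x - ξ₁) + Real.exp (y - ξ₁)) * ((min 1 |x - y|) ^ 2
          / |x - y| ^ (1 + 2 * σ)) := by ring
    _ ≤ _ := by gcongr

lemma exp_lint (a : ℝ) : ∫⁻ x in Set.Iic a, ENNReal.ofReal (Real.exp (x - a)) = 1 := by
  have hi : IntegrableOn (fun x : ℝ => Real.exp (x - a)) (Set.Iic a) := by
    simp only [Real.exp_sub]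
    exact (integrableOn_exp_Iic a).div_const _
  rw [← ofReal_integral_eq_lintegral_ofReal hi (ae_of_all _ fun x => (Real.exp_pos _).le)]
  simp only [Real.exp_sub, integral_div, integral_exp_Iic]
  rw [div_self (Real.exp_pos a).ne']
  simp

lemma conv_bound (σ a : ℝ) :
    ∫⁻ y in Set.Iic a, ∫⁻ x in Set.Iic a,
      ENNReal.ofReal (Real.exp (y - a)) * ENNReal.ofReal (kerF σ |x - y|) ≤
      ∫⁻ t : ℝ, ENNReal.ofReal (kerF σ |t|) := by
  have hm := kerF_measurable σ
  calc _ ≤ ∫⁻ y in Set.Iic a, ENNReal.ofReal (Real.exp (y - a)) *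
          ∫⁻ t : ℝ, ENNReal.ofReal (kerF σ |t|) := by
        refine lintegral_mono fun y => ?_
        rw [lintegral_const_mul _ (by fun_prop)]
        refine mul_le_mul_right ?_ _
        refine (setLIntegral_le_lintegral _ _).trans ?_
        rw [lintegral_sub_right_eq_self (fun t => ENNReal.ofReal (kerF σ |t|)) y]
    _ = _ := by
        rw [lintegral_mul_const _ (by fun_prop), exp_lint, one_mul]

lemma conv_bound' (σ a : ℝ) :
    ∫⁻ y in Set.Iic a, ∫⁻ x in Set.Iic a,
      ENNReal.ofReal (Real.exp (x - a)) * ENNReal.ofReal (kerF σ |x - y|) ≤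
      ∫⁻ t : ℝ, ENNReal.ofReal (kerF σ |t|) := by
  have hm := kerF_measurable σ
  rw [lintegral_lintegral_swap (by fun_prop)]
  refine le_trans (le_of_eq ?_) (conv_bound σ a)
  refine lintegral_congr fun x => lintegral_congr fun y => ?_
  rw [abs_sub_comm]

/-- For `0 < σ < 1/2` and `ξ₁ ≤ ξ₂`:
`∫_{-∞}^{ξ₁} ∫_{-∞}^{ξ₁} (E₁(ξ) - E₁(η))² / |ξ-η|^{1+2σ} dξ dη ≤ C(σ) (ξ₂-ξ₁)²`,
where both variables range over `(-∞, ξ₁]`. -/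
theorem E1_diag_bound (σ : ℝ) (hσ₁ : 0 < σ) (hσ₂ : σ < 1 / 2) :
    ∃ C : ℝ, 0 < C ∧ ∀ ξ₁ ξ₂ : ℝ, ξ₁ ≤ ξ₂ →
      (∫⁻ η in Set.Iic ξ₁, ∫⁻ ξ in Set.Iic ξ₁,
          ENNReal.ofReal ((E1 ξ₁ ξ₂ ξ - E1 ξ₁ ξ₂ η) ^ 2 / |ξ - η| ^ (1 + 2 * σ))) ≤
        ENNReal.ofReal (C * (ξ₂ - ξ₁) ^ 2) := by
  have hm := kerF_measurable σ
  have hint := kerF_integrable σ hσ₁ hσ₂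
  have hn : ∀ t : ℝ, 0 ≤ kerF σ |t| := fun t => kerF_nonneg σ (abs_nonneg t)
  set k : ℝ := ∫ t : ℝ, kerF σ |t| with hk
  have hM : ∫⁻ t : ℝ, ENNReal.ofReal (kerF σ |t|) = ENNReal.ofReal k :=
    (ofReal_integral_eq_lintegral_ofReal hint (ae_of_all _ hn)).symm
  have hk0 : 0 ≤ k := integral_nonneg hn
  refine ⟨2 * k + 1, by positivity, fun ξ₁ ξ₂ h => ?_⟩
  calc _ ≤ ∫⁻ y in Set.Iic ξ₁, ∫⁻ x in Set.Iic ξ₁, ENNReal.ofReal ((ξ₂ - ξ₁) ^ 2) *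
          (ENNReal.ofReal (Real.exp (x - ξ₁)) * ENNReal.ofReal (kerF σ |x - y|) +
           ENNReal.ofReal (Real.exp (y - ξ₁)) * ENNReal.ofReal (kerF σ |x - y|)) := by
        refine setLIntegral_mono' measurableSet_Iic fun y hy => ?_
        refine setLIntegral_mono' measurableSet_Iic fun x hx => ?_
        refine (ENNReal.ofReal_le_ofReal (point_bound σ ξ₁ ξ₂ x y h hx hy)).trans (le_of_eq ?_)
        have := hn (x - y)
        rw [ENNReal.ofReal_mul (by positivity), ENNReal.ofReal_add (by positivity) (by positivity),
          ENNReal.ofReal_mul (by positivity), ENNReal.ofReal_mul (by positivity)]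
    _ = ENNReal.ofReal ((ξ₂ - ξ₁) ^ 2) *
          ((∫⁻ y in Set.Iic ξ₁, ∫⁻ x in Set.Iic ξ₁,
            ENNReal.ofReal (Real.exp (x - ξ₁)) * ENNReal.ofReal (kerF σ |x - y|)) +
           ∫⁻ y in Set.Iic ξ₁, ∫⁻ x in Set.Iic ξ₁,
            ENNReal.ofReal (Real.exp (y - ξ₁)) * ENNReal.ofReal (kerF σ |x - y|)) := by
        rw [← lintegral_add_left
          (Measurable.lintegral_prod_right' (f := fun p : ℝ × ℝ =>
            ENNReal.ofReal (Real.exp (p.2 - ξ₁)) * ENNReal.ofReal (kerF σ |p.2 - p.1|))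
            (by fun_prop)),
          ← lintegral_const_mul' _ _ ENNReal.ofReal_ne_top]
        refine lintegral_congr fun y => ?_
        rw [lintegral_const_mul' _ _ ENNReal.ofReal_ne_top, lintegral_add_left (by fun_prop)]
    _ ≤ ENNReal.ofReal ((ξ₂ - ξ₁) ^ 2) * (ENNReal.ofReal k + ENNReal.ofReal k) := by
        rw [← hM]
        exact mul_le_mul_right (add_le_add (conv_bound' σ ξ₁) (conv_bound σ ξ₁)) _
    _ ≤ _ := by
        rw [← ENNReal.ofReal_add hk0 hk0, ← ENNReal.ofReal_mul (by positivity)]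
        apply ENNReal.ofReal_le_ofReal
        nlinarith [sq_nonneg (ξ₂ - ξ₁)]
end

section
/- Let 0 < σ < 1/2 and let ξ₁ ≤ ξ₂ be real numbers. Then there is a constant C(σ) > 0 depending only on σ such that the Gagliardo seminorm satisfies ∫_ℝ ∫_ℝ (E₁(ξ; ξ₁, ξ₂) − E₁(η; ξ₁, ξ₂))² / |ξ − η|^{1+2σ} dξ dη ≤ C(σ) (ξ₂ − ξ₁)². -/
open MeasureTheory

/-- The model profile `e^x` on `x ≤ 0`, zero otherwise. -/
noncomputable def gg (x : ℝ) : ℝ := if x ≤ 0 then Real.exp x else 0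

lemma gg_meas : Measurable gg := by
  unfold gg
  exact Measurable.ite measurableSet_Iic Real.measurable_exp measurable_const

lemma gg_nonneg (x : ℝ) : 0 ≤ gg x := by
  unfold gg; split_ifs <;> positivity

lemma gg_le_one (x : ℝ) : gg x ≤ 1 := by
  unfold gg; split_ifs with h
  · exact Real.exp_le_one_iff.2 h
  · norm_num

lemma gg_sq_int : ∫⁻ x, ENNReal.ofReal (gg x ^ 2) ≤ 1 := by
  calc ∫⁻ x, ENNReal.ofReal (gg x ^ 2)
      ≤ ∫⁻ x, (Set.Iic (0:ℝ)).indicator (fun x => ENNReal.ofReal (Real.exp x)) x := by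
        apply lintegral_mono
        intro x
        by_cases h : x ≤ 0
        · rw [Set.indicator_of_mem (by exact h)]
          apply ENNReal.ofReal_le_ofReal
          have h1 := gg_le_one x
          have h0 := gg_nonneg x
          have : gg x = Real.exp x := by simp [gg, h]
          rw [← this]; nlinarith
        · simp [gg, h]
    _ = ∫⁻ x in Set.Iic (0:ℝ), ENNReal.ofReal (Real.exp x) := lintegral_indicator measurableSet_Iic _
    _ = ENNReal.ofReal (∫ x in Set.Iic (0:ℝ), Real.exp x) := by
        rw [ofReal_integral_eq_lintegral_ofReal]
        · exact integrableOn_exp_Iic 0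
        · exact Filter.Eventually.of_forall fun x => (Real.exp_pos x).le
    _ ≤ 1 := by rw [integral_exp_Iic_zero]; simp

noncomputable def DD (t : ℝ) : ENNReal := ∫⁻ x, ENNReal.ofReal ((gg (x + t) - gg x) ^ 2)

lemma DD_neg (t : ℝ) : DD (-t) = DD t := by
  unfold DD
  rw [← lintegral_add_right_eq_self _ t]
  apply lintegral_congr
  intro x
  congr 1
  rw [add_neg_cancel_right]; ring

lemma DD_le_two (t : ℝ) : DD t ≤ 2 := by
  unfold DD
  calc _ ≤ ∫⁻ x, (ENNReal.ofReal (gg (x + t) ^ 2) + ENNReal.ofReal (gg x ^ 2)) := by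
        apply lintegral_mono
        intro x
        dsimp only
        rw [← ENNReal.ofReal_add (by positivity) (by positivity)]
        apply ENNReal.ofReal_le_ofReal
        nlinarith [mul_nonneg (gg_nonneg (x+t)) (gg_nonneg x)]
    _ = (∫⁻ x, ENNReal.ofReal (gg (x + t) ^ 2)) + ∫⁻ x, ENNReal.ofReal (gg x ^ 2) := by
        apply lintegral_add_right
        exact (gg_meas.pow_const 2).ennreal_ofReal
    _ ≤ 1 + 1 := by
        rw [lintegral_add_right_eq_self (fun x => ENNReal.ofReal (gg x ^ 2)) t]
        exact add_le_add gg_sq_int gg_sq_int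
    _ = 2 := by norm_num

lemma DD_le_lin (t : ℝ) (h0 : 0 ≤ t) (h1 : t ≤ 1) : DD t ≤ ENNReal.ofReal (2 * t) := by
  unfold DD
  calc _ ≤ ∫⁻ x, (ENNReal.ofReal (t^2) * ENNReal.ofReal (gg (x + t) ^ 2)
            + (Set.Ioc (-t) 0).indicator 1 x) := by
        apply lintegral_mono
        intro x
        dsimp only
        by_cases hx : x + t ≤ 0
        · refine le_trans ?_ le_self_add
          rw [← ENNReal.ofReal_mul (by positivity)]
          apply ENNReal.ofReal_le_ofReal
          have hx' : x ≤ 0 := by linarith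
          simp only [gg, hx, hx', if_true]
          rw [← mul_pow]
          have e1 : Real.exp x = Real.exp (x+t) * Real.exp (-t) := by
            rw [← Real.exp_add]; ring_nf
          have e2 := Real.add_one_le_exp (-t)
          have e3 : Real.exp (-t) ≤ 1 := Real.exp_le_one_iff.2 (by linarith)
          have e4 := Real.exp_pos (x+t)
          apply pow_le_pow_left₀
          · rw [e1]; nlinarith
          · rw [e1]; nlinarith
        · by_cases hx' : x ≤ 0
          · refine le_trans ?_ le_add_self
            rw [Set.indicator_of_mem (by constructor <;> linarith)]
            simp only [Pi.one_apply]
            rw [← ENNReal.ofReal_one]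
            apply ENNReal.ofReal_le_ofReal
            have : gg (x+t) = 0 := by simp [gg, hx]
            rw [this]
            nlinarith [gg_nonneg x, gg_le_one x]
          · simp [gg, hx, hx']
    _ = ENNReal.ofReal (t^2) * (∫⁻ x, ENNReal.ofReal (gg (x + t) ^ 2)) + ENNReal.ofReal t := by
        rw [lintegral_add_right _ (measurable_one.indicator measurableSet_Ioc),
          lintegral_indicator_one measurableSet_Ioc, lintegral_const_mul']
        · simp
        · simp
    _ ≤ ENNReal.ofReal (t^2) * 1 + ENNReal.ofReal t := by
        rw [lintegral_add_right_eq_self (fun x => ENNReal.ofReal (gg x ^ 2)) t]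
        gcongr
        exact gg_sq_int
    _ ≤ ENNReal.ofReal (2 * t) := by
        rw [mul_one, ← ENNReal.ofReal_add (by positivity) h0]
        apply ENNReal.ofReal_le_ofReal
        nlinarith

noncomputable def KK (σ : ℝ) : ENNReal := ∫⁻ t : ℝ, DD t * ENNReal.ofReal ((|t| ^ (1 + 2 * σ))⁻¹)

noncomputable def kk (σ : ℝ) (t : ℝ) : ENNReal :=
  (Set.Ioc (0:ℝ) 1).indicator (fun t => ENNReal.ofReal (2 * t ^ (- (2 * σ)))) t +
  (Set.Ioi (1:ℝ)).indicator (fun t => ENNReal.ofReal (2 * t ^ (- (1 + 2 * σ)))) t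

lemma kk_bound (σ t : ℝ) (ht : 0 < t) :
    DD t * ENNReal.ofReal ((|t| ^ (1 + 2 * σ))⁻¹) ≤ kk σ t := by
  rw [abs_of_pos ht, ← Real.rpow_neg ht.le]
  unfold kk
  by_cases h : t ≤ 1
  · refine le_trans ?_ le_self_add
    rw [Set.indicator_of_mem (by exact ⟨ht, h⟩)]
    refine (mul_le_mul_left (DD_le_lin t ht.le h) _).trans ?_
    rw [← ENNReal.ofReal_mul (by positivity)]
    apply ENNReal.ofReal_le_ofReal
    have : t ^ (-(2*σ)) = t * t ^ (-(1 + 2*σ)) := by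
      nth_rewrite 2 [← Real.rpow_one t]
      rw [← Real.rpow_add ht]; ring_nf
    rw [this, mul_assoc]
  · refine le_trans ?_ le_add_self
    rw [Set.indicator_of_mem (by exact not_le.1 h)]
    rw [ENNReal.ofReal_mul (by norm_num)]
    have := DD_le_two t
    simpa using mul_le_mul_left this _

lemma kk_meas (σ : ℝ) : Measurable (kk σ) := by
  unfold kk
  apply Measurable.add
  · exact Measurable.indicator (by fun_prop) measurableSet_Ioc
  · exact Measurable.indicator (by fun_prop) measurableSet_Ioi

lemma kk_fin (σ : ℝ) (hσ₁ : 0 < σ) (hσ₂ : σ < 1 / 2) : ∫⁻ t, kk σ t < ⊤ := by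
  unfold kk
  rw [lintegral_add_left (Measurable.indicator (by fun_prop) measurableSet_Ioc),
    lintegral_indicator measurableSet_Ioc, lintegral_indicator measurableSet_Ioi]
  apply ENNReal.add_lt_top.2
  constructor
  · have h : IntegrableOn (fun t : ℝ => 2 * t ^ (-(2*σ))) (Set.Ioc 0 1) := by
      have := intervalIntegral.intervalIntegrable_rpow' (a := 0) (b := 1)
        (r := -(2*σ)) (by linarith)
      rw [intervalIntegrable_iff_integrableOn_Ioc_of_le (by norm_num)] at this
      exact this.const_mul 2
    exact h.lintegral_lt_top
  · have h : IntegrableOn (fun t : ℝ => 2 * t ^ (-(1 + 2*σ))) (Set.Ioi 1) := by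
      have := integrableOn_Ioi_rpow_of_lt (a := -(1+2*σ)) (by linarith) (c := 1) (by norm_num)
      exact this.const_mul 2
    exact h.lintegral_lt_top

lemma KK_fin (σ : ℝ) (hσ₁ : 0 < σ) (hσ₂ : σ < 1 / 2) : KK σ < ⊤ := by
  have : KK σ ≤ ∫⁻ t, (kk σ t + kk σ (-t)) := by
    apply lintegral_mono
    intro t
    dsimp only
    rcases lt_trichotomy t 0 with h | h | h
    · refine le_trans ?_ le_add_self
      have := kk_bound σ (-t) (by linarith)
      rwa [abs_neg, DD_neg] at this
    · subst h
      rw [abs_zero, Real.zero_rpow (by linarith)]; simp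
    · exact (kk_bound σ t h).trans le_self_add
  refine this.trans_lt ?_
  rw [lintegral_add_left (kk_meas σ), lintegral_neg_eq_self (kk σ)]
  exact ENNReal.add_lt_top.2 ⟨kk_fin σ hσ₁ hσ₂, kk_fin σ hσ₁ hσ₂⟩

lemma E1_eq (a b x : ℝ) : E1 a b x = (1 - Real.exp (a - b)) * gg (x - a) := by
  unfold E1 gg
  by_cases h : x ≤ a
  · rw [if_pos h, if_pos (by linarith), sub_mul, ← Real.exp_add]; ring_nf
  · rw [if_neg h, if_neg (by linarith)]; ring

lemma E1_int (σ a b : ℝ) :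
    (∫⁻ η : ℝ, ∫⁻ ξ : ℝ,
          ENNReal.ofReal ((E1 a b ξ - E1 a b η) ^ 2 / |ξ - η| ^ (1 + 2 * σ))) =
      ENNReal.ofReal ((1 - Real.exp (a - b)) ^ 2) * KK σ := by
  have hm := gg_meas
  set c := (1 - Real.exp (a - b)) ^ 2 with hc
  calc _ = ∫⁻ η : ℝ, ∫⁻ t : ℝ, ENNReal.ofReal c *
        (ENNReal.ofReal ((gg (η - a + t) - gg (η - a)) ^ 2) *
          ENNReal.ofReal ((|t| ^ (1 + 2 * σ))⁻¹)) := by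
        apply lintegral_congr
        intro η
        rw [← lintegral_add_right_eq_self _ η]
        apply lintegral_congr
        intro t
        rw [← ENNReal.ofReal_mul (by positivity), ← ENNReal.ofReal_mul (by positivity),
          E1_eq, E1_eq, add_sub_cancel_right, show t + η - a = η - a + t by ring]
        congr 1
        rw [div_eq_mul_inv, hc]; ring
    _ = ∫⁻ η : ℝ, ∫⁻ t : ℝ, ENNReal.ofReal c *
        (ENNReal.ofReal ((gg (η + t) - gg η) ^ 2) *
          ENNReal.ofReal ((|t| ^ (1 + 2 * σ))⁻¹)) :=
        lintegral_sub_right_eq_self (fun η => ∫⁻ t : ℝ, ENNReal.ofReal c *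
        (ENNReal.ofReal ((gg (η + t) - gg η) ^ 2) *
          ENNReal.ofReal ((|t| ^ (1 + 2 * σ))⁻¹))) a
    _ = ∫⁻ t : ℝ, ∫⁻ η : ℝ, ENNReal.ofReal c *
        (ENNReal.ofReal ((gg (η + t) - gg η) ^ 2) *
          ENNReal.ofReal ((|t| ^ (1 + 2 * σ))⁻¹)) := by
        apply lintegral_lintegral_swap
        apply Measurable.aemeasurable
        unfold Function.uncurry
        fun_prop
    _ = ENNReal.ofReal c * KK σ := by
        unfold KK DD
        rw [← lintegral_const_mul' _ _ ENNReal.ofReal_ne_top]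
        apply lintegral_congr
        intro t
        rw [lintegral_const_mul' _ _ ENNReal.ofReal_ne_top,
          lintegral_mul_const' _ _ ENNReal.ofReal_ne_top]

/-- For `0 < σ < 1/2` and `ξ₁ ≤ ξ₂`, the Gagliardo seminorm of `E₁` satisfies
`∫_ℝ ∫_ℝ (E₁(ξ) - E₁(η))² / |ξ-η|^{1+2σ} dξ dη ≤ C(σ) (ξ₂-ξ₁)²`. -/
theorem E1_gagliardo_bound (σ : ℝ) (hσ₁ : 0 < σ) (hσ₂ : σ < 1 / 2) :
    ∃ C : ℝ, 0 < C ∧ ∀ ξ₁ ξ₂ : ℝ, ξ₁ ≤ ξ₂ →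
      (∫⁻ η : ℝ, ∫⁻ ξ : ℝ,
          ENNReal.ofReal ((E1 ξ₁ ξ₂ ξ - E1 ξ₁ ξ₂ η) ^ 2 / |ξ - η| ^ (1 + 2 * σ))) ≤
        ENNReal.ofReal (C * (ξ₂ - ξ₁) ^ 2) := by
  refine ⟨(KK σ).toReal + 1, by positivity, ?_⟩
  intro a b hab
  rw [E1_int, ← ENNReal.ofReal_toReal (KK_fin σ hσ₁ hσ₂).ne, ← ENNReal.ofReal_mul (by positivity)]
  rw [ENNReal.toReal_ofReal ENNReal.toReal_nonneg]
  apply ENNReal.ofReal_le_ofReal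
  have e1 := Real.add_one_le_exp (a - b)
  have e2 : Real.exp (a - b) ≤ 1 := Real.exp_le_one_iff.2 (by linarith)
  have h : (1 - Real.exp (a - b)) ^ 2 ≤ (b - a) ^ 2 :=
    pow_le_pow_left₀ (by linarith) (by linarith) 2
  have hk : 0 ≤ (KK σ).toReal := ENNReal.toReal_nonneg
  nlinarith [mul_le_mul_of_nonneg_left h hk, sq_nonneg (b - a)]
end

section
/- Let 0 < σ < 1/2 and let ξ₁ ≤ ξ₂ be real numbers with ξ₂ − ξ₁ ≤ 1. Then there is a constant C(σ) > 0 depending only on σ such that ∫_{ξ₁}^{ξ₂} ∫_{ξ₂}^{∞} e^{2(η−ξ₂)} / (ξ − η)^{1+2σ} dξ dη ≤ C(σ) (ξ₂ − ξ₁)^{1−2σ}, where the inner integration variable ξ ranges over [ξ₂, ∞) and η over [ξ₁, ξ₂]. -/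
open MeasureTheory

lemma inner_aux (σ : ℝ) (hσ₁ : 0 < σ) (a η : ℝ) (h : η < a) :
    (∫⁻ ξ in Set.Ici a,
          ENNReal.ofReal (Real.exp (2 * (η - a)) / (ξ - η) ^ (1 + 2 * σ))) ≤
      ENNReal.ofReal (1 / (2 * σ) * (a - η) ^ (-(2 * σ))) := by
  have hd : 0 < a - η := sub_pos.2 h
  have key := (measurePreserving_sub_right (volume : Measure ℝ) η).setLIntegral_comp_preimage_emb
    (MeasurableEquiv.subRight η).measurableEmbedding
    (fun x => ENNReal.ofReal (x ^ (-(1 + 2 * σ)))) (Set.Ioi (a - η))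
  have hpre : (fun x => x - η) ⁻¹' Set.Ioi (a - η) = Set.Ioi a := by
    ext x; simp
  rw [hpre] at key
  rw [setLIntegral_congr Ioi_ae_eq_Ici.symm]
  calc _ ≤ ∫⁻ ξ in Set.Ioi a, ENNReal.ofReal ((ξ - η) ^ (-(1 + 2 * σ))) := by
        refine setLIntegral_mono' measurableSet_Ioi fun x hx => ENNReal.ofReal_le_ofReal ?_
        have hx' : 0 < x - η := by have : a < x := hx; linarith
        rw [Real.rpow_neg hx'.le, div_eq_mul_inv]
        refine mul_le_of_le_one_left (by positivity) ?_
        rw [Real.exp_le_one_iff]; linarith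
    _ = _ := by
        rw [key, ← ofReal_integral_eq_lintegral_ofReal
          (integrableOn_Ioi_rpow_of_lt (by linarith) hd), integral_Ioi_rpow_of_lt (by linarith) hd]
        · congr 1
          have : -(1 + 2 * σ) + 1 = -(2 * σ) := by ring
          rw [this]; field_simp
        · refine (ae_restrict_mem measurableSet_Ioi).mono fun x hx => ?_
          exact Real.rpow_nonneg (hd.trans hx).le _

/-- For `0 < σ < 1/2` and `ξ₁ ≤ ξ₂` with `ξ₂ - ξ₁ ≤ 1`:
`∫_{ξ₁}^{ξ₂} ∫_{ξ₂}^{∞} e^{2(η-ξ₂)} / (ξ-η)^{1+2σ} dξ dη ≤ C(σ) (ξ₂-ξ₁)^{1-2σ}`,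
where `ξ` ranges over `[ξ₂, ∞)` and `η` over `[ξ₁, ξ₂]`; the inequality is in `ℝ≥0∞`. -/
theorem checkI4_bound (σ : ℝ) (hσ₁ : 0 < σ) (hσ₂ : σ < 1 / 2) :
    ∃ C : ℝ, 0 < C ∧ ∀ ξ₁ ξ₂ : ℝ, ξ₁ ≤ ξ₂ → ξ₂ - ξ₁ ≤ 1 →
      (∫⁻ η in Set.Icc ξ₁ ξ₂, ∫⁻ ξ in Set.Ici ξ₂,
          ENNReal.ofReal (Real.exp (2 * (η - ξ₂)) / (ξ - η) ^ (1 + 2 * σ))) ≤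
        ENNReal.ofReal (C * (ξ₂ - ξ₁) ^ (1 - 2 * σ)) := by
  have h1 : 0 < 1 - 2 * σ := by linarith
  refine ⟨1 / (2 * σ) * (1 / (1 - 2 * σ)), by positivity, fun a b hab _ => ?_⟩
  have hd : 0 ≤ b - a := sub_nonneg.2 hab
  have key := (Measure.measurePreserving_sub_left (volume : Measure ℝ) b).setLIntegral_comp_preimage_emb
    (MeasurableEquiv.subLeft b).measurableEmbedding
    (fun x => ENNReal.ofReal (1 / (2 * σ) * x ^ (-(2 * σ)))) (Set.Ioc 0 (b - a))
  have hpre : (fun x => b - x) ⁻¹' Set.Ioc 0 (b - a) = Set.Ico a b := by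
    ext x; simp [and_comm]
  rw [hpre] at key
  rw [setLIntegral_congr Ico_ae_eq_Icc.symm]
  refine (setLIntegral_mono' measurableSet_Ico fun x hx => inner_aux σ hσ₁ b x hx.2).trans ?_
  have hint : IntegrableOn (fun x : ℝ => 1 / (2 * σ) * x ^ (-(2 * σ))) (Set.Ioc 0 (b - a)) := by
    have := (intervalIntegral.intervalIntegrable_rpow' (a := 0) (b := b - a)
      (r := -(2 * σ)) (by linarith)).const_mul (1 / (2 * σ))
    exact (intervalIntegrable_iff_integrableOn_Ioc_of_le hd).1 this
  rw [key, ← ofReal_integral_eq_lintegral_ofReal hint]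
  · apply le_of_eq
    congr 1
    rw [← intervalIntegral.integral_of_le hd, intervalIntegral.integral_const_mul,
      integral_rpow (Or.inl (by linarith))]
    have : -(2 * σ) + 1 = 1 - 2 * σ := by ring
    rw [this, Real.zero_rpow h1.ne']
    ring
  · refine (ae_restrict_mem measurableSet_Ioc).mono fun x hx => ?_
    have := Real.rpow_nonneg hx.1.le (-(2 * σ))
    simp only [Pi.zero_apply]
    positivity
end

section
/- Let 0 < σ < 1/2 and let ξ₁ ≤ ξ₂ be real numbers with ξ₂ − ξ₁ ≤ 1. Then there is a constant C(σ) > 0 depending only on σ such that ∫_{ξ₁}^{ξ₂} ∫_{ξ₁}^{ξ₂} (e^{ξ−ξ₂} − e^{η−ξ₂})² / |ξ − η|^{1+2σ} dξ dη ≤ C(σ) (ξ₂ − ξ₁)^{1−2σ}. -/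
open MeasureTheory

lemma exp_diff_aux (a b : ℝ) (ha : a ≤ 0) (hb : b ≤ 0) :
    |Real.exp a - Real.exp b| ≤ |a - b| := by
  have key : ∀ a b : ℝ, a ≤ 0 → b ≤ a → |Real.exp a - Real.exp b| ≤ |a - b| := by
    intro a b ha hab
    have h1 : Real.exp b ≤ Real.exp a := Real.exp_le_exp.2 hab
    rw [abs_of_nonneg (by linarith), abs_of_nonneg (by linarith)]
    have h2 : Real.exp b = Real.exp a * Real.exp (b - a) := by
      rw [← Real.exp_add]; congr 1; ring
    have h3 := Real.add_one_le_exp (b - a)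
    have h4 : Real.exp a ≤ 1 := Real.exp_le_one_iff.2 ha
    have h5 := Real.exp_pos a
    rw [h2]
    nlinarith
  rcases le_total b a with h | h
  · exact key a b ha h
  · rw [abs_sub_comm, abs_sub_comm a b]
    exact key b a hb h

lemma integrand_aux (σ : ℝ) (hσ₂ : σ < 1 / 2) (x₁ x₂ x y : ℝ)
    (hx : x ∈ Set.Icc x₁ x₂) (hy : y ∈ Set.Icc x₁ x₂) :
    (Real.exp (x - x₂) - Real.exp (y - x₂)) ^ 2 / |x - y| ^ (1 + 2 * σ)
      ≤ (x₂ - x₁) ^ (1 - 2 * σ) := by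
  obtain ⟨hx1, hx2⟩ := hx
  obtain ⟨hy1, hy2⟩ := hy
  have hL : 0 ≤ x₂ - x₁ := by linarith
  rcases eq_or_ne x y with h | h
  · subst h
    simp only [sub_self, ne_eq, OfNat.ofNat_ne_zero, not_false_eq_true, zero_pow, zero_div]
    positivity
  · have hd : 0 < |x - y| := abs_pos.2 (sub_ne_zero.2 h)
    have h1 := exp_diff_aux (x - x₂) (y - x₂) (by linarith) (by linarith)
    rw [show x - x₂ - (y - x₂) = x - y by ring] at h1
    have h2 : (Real.exp (x - x₂) - Real.exp (y - x₂)) ^ 2 ≤ |x - y| ^ 2 := by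
      rw [← sq_abs]
      exact pow_le_pow_left₀ (abs_nonneg _) h1 2
    have h3 : |x - y| ≤ x₂ - x₁ := abs_le.2 ⟨by linarith, by linarith⟩
    calc _ ≤ |x - y| ^ 2 / |x - y| ^ (1 + 2 * σ) := by gcongr
      _ = |x - y| ^ (1 - 2 * σ) := by
        rw [← Real.rpow_natCast, ← Real.rpow_sub hd]; congr 1; push_cast; ring
      _ ≤ _ := Real.rpow_le_rpow hd.le h3 (by linarith)

/-- For `0 < σ < 1/2` and `ξ₁ ≤ ξ₂` with `ξ₂ - ξ₁ ≤ 1`: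
`∫_{ξ₁}^{ξ₂} ∫_{ξ₁}^{ξ₂} (e^{ξ-ξ₂} - e^{η-ξ₂})² / |ξ-η|^{1+2σ} dξ dη ≤ C(σ) (ξ₂-ξ₁)^{1-2σ}`,
both variables ranging over `[ξ₁, ξ₂]`; the inequality is in `ℝ≥0∞`. -/
theorem checkI5_bound (σ : ℝ) (hσ₁ : 0 < σ) (hσ₂ : σ < 1 / 2) :
    ∃ C : ℝ, 0 < C ∧ ∀ ξ₁ ξ₂ : ℝ, ξ₁ ≤ ξ₂ → ξ₂ - ξ₁ ≤ 1 →
      (∫⁻ η in Set.Icc ξ₁ ξ₂, ∫⁻ ξ in Set.Icc ξ₁ ξ₂,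
          ENNReal.ofReal ((Real.exp (ξ - ξ₂) - Real.exp (η - ξ₂)) ^ 2 / |ξ - η| ^ (1 + 2 * σ))) ≤
        ENNReal.ofReal (C * (ξ₂ - ξ₁) ^ (1 - 2 * σ)) := by
  refine ⟨1, one_pos, ?_⟩
  intro x₁ x₂ h12 hle
  have hvol : volume (Set.Icc x₁ x₂) ≤ 1 := by
    rw [Real.volume_Icc]
    exact ENNReal.ofReal_le_one.2 hle
  have hconst : ∀ c : ENNReal, (∫⁻ _ in Set.Icc x₁ x₂, c) ≤ c := by
    intro c
    rw [setLIntegral_const]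
    exact mul_le_of_le_one_right' hvol
  rw [one_mul]
  refine le_trans ?_ (hconst _)
  refine setLIntegral_mono' measurableSet_Icc ?_
  intro y hy
  refine le_trans ?_ (hconst _)
  refine setLIntegral_mono' measurableSet_Icc ?_
  intro x hx
  exact ENNReal.ofReal_le_ofReal (integrand_aux σ hσ₂ x₁ x₂ x y hx hy)
end

section
/- Let 0 < σ < 1/2 and let ξ₁ ≤ ξ₂ be real numbers with ξ₂ − ξ₁ ≤ 1. Then there is a constant C(σ) > 0 depending only on σ such that the Gagliardo seminorm satisfies ∫_ℝ ∫_ℝ (E₂(ξ; ξ₁, ξ₂) − E₂(η; ξ₁, ξ₂))² / |ξ − η|^{1+2σ} dξ dη ≤ C(σ) (ξ₂ − ξ₁)^{1−2σ}. -/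
open MeasureTheory

lemma E2_meas (a b : ℝ) : Measurable (E2 a b) := by
  unfold E2
  refine Measurable.ite ?_ (by fun_prop) measurable_const
  exact measurableSet_Icc

lemma E2_nonneg (a b x : ℝ) : 0 ≤ E2 a b x := by
  unfold E2; split_ifs <;> positivity

lemma E2_le_one (a b x : ℝ) : E2 a b x ≤ 1 := by
  unfold E2; split_ifs with h
  · exact Real.exp_le_one_iff.2 (by linarith [h.2])
  · norm_num

lemma E2_zero (a b x : ℝ) (h : x ∉ Set.Icc a b) : E2 a b x = 0 := by
  unfold E2; exact if_neg h

lemma E2_sq_le_one (a b x y : ℝ) : (E2 a b x - E2 a b y) ^ 2 ≤ 1 := by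
  have := E2_nonneg a b x
  have := E2_nonneg a b y
  have := E2_le_one a b x
  have := E2_le_one a b y
  rw [sq_le_one_iff_abs_le_one, abs_le]
  constructor <;> linarith

lemma exp_lip (u v : ℝ) (hu : u ≤ 0) (huv : v ≤ u) : Real.exp u - Real.exp v ≤ u - v := by
  have h1 : Real.exp v = Real.exp u * Real.exp (v - u) := by
    rw [← Real.exp_add]; congr 1; ring
  have h2 := Real.add_one_le_exp (v - u)
  have h3 := Real.exp_le_one_iff.2 hu
  have h4 := Real.exp_pos u
  rw [h1]
  nlinarith

lemma E2_lip (a b x y : ℝ) (hx : x ∈ Set.Icc a b) (hy : y ∈ Set.Icc a b) :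
    |E2 a b x - E2 a b y| ≤ |x - y| := by
  have ex : E2 a b x = Real.exp (x - b) := if_pos hx
  have ey : E2 a b y = Real.exp (y - b) := if_pos hy
  rw [ex, ey]
  rcases le_total x y with h | h
  · rw [abs_sub_comm, abs_sub_comm x y, abs_of_nonneg (by linarith : 0 ≤ y - x),
      abs_of_nonneg (sub_nonneg.2 (Real.exp_le_exp.2 (by linarith)))]
    have := exp_lip (y - b) (x - b) (by linarith [hy.2]) (by linarith)
    linarith
  · rw [abs_of_nonneg (by linarith : 0 ≤ x - y),
      abs_of_nonneg (sub_nonneg.2 (Real.exp_le_exp.2 (by linarith)))]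
    have := exp_lip (x - b) (y - b) (by linarith [hx.2]) (by linarith)
    linarith

lemma g_le_L (a b h : ℝ) (hab : a ≤ b) :
    (∫⁻ η : ℝ, ENNReal.ofReal ((E2 a b (h + η) - E2 a b η) ^ 2)) ≤ ENNReal.ofReal (2 * (b - a)) := by
  calc _ ≤ ∫⁻ η : ℝ, (Set.Icc a b ∪ Set.Icc (a - h) (b - h)).indicator 1 η := by
        apply lintegral_mono
        intro η
        by_cases hη : η ∈ Set.Icc a b ∪ Set.Icc (a - h) (b - h)
        · simp only [Set.indicator_of_mem hη, Pi.one_apply]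
          exact ENNReal.ofReal_le_one.2 (E2_sq_le_one _ _ _ _)
        · have h1 : η ∉ Set.Icc a b := fun hh => hη (Or.inl hh)
          have h2 : h + η ∉ Set.Icc a b := fun hh => hη (Or.inr
            ⟨by linarith [hh.1], by linarith [hh.2]⟩)
          simp [E2_zero _ _ _ h1, E2_zero _ _ _ h2]
    _ = volume (Set.Icc a b ∪ Set.Icc (a - h) (b - h)) :=
        lintegral_indicator_one (measurableSet_Icc.union measurableSet_Icc)
    _ ≤ _ := measure_union_le _ _
    _ = _ := by
        rw [Real.volume_Icc, Real.volume_Icc, ← ENNReal.ofReal_add (by linarith) (by linarith)]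
        congr 1; ring

lemma g_le_h (a b h : ℝ) (hab : a ≤ b) (hL : b - a ≤ 1) (hh : |h| ≤ b - a) :
    (∫⁻ η : ℝ, ENNReal.ofReal ((E2 a b (h + η) - E2 a b η) ^ 2)) ≤ ENNReal.ofReal (5 * |h|) := by
  have hh0 := abs_nonneg h
  set B := Set.Icc (a - |h|) (a + |h|) ∪ Set.Icc (b - |h|) (b + |h|) with hB
  have hBm : MeasurableSet B := measurableSet_Icc.union measurableSet_Icc
  calc _ ≤ ∫⁻ η : ℝ, ((Set.Icc a b).indicator (fun _ => ENNReal.ofReal |h|) η + B.indicator 1 η) := by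
        apply lintegral_mono
        intro η
        by_cases hη : η ∈ B
        · simp only [Set.indicator_of_mem hη, Pi.one_apply]
          exact (ENNReal.ofReal_le_one.2 (E2_sq_le_one _ _ _ _)).trans le_add_self
        · have k1 := le_abs_self h
          have k2 := neg_abs_le h
          have c1 : ¬ (a - |h| ≤ η ∧ η ≤ a + |h|) := fun c => hη (Or.inl c)
          have c2 : ¬ (b - |h| ≤ η ∧ η ≤ b + |h|) := fun c => hη (Or.inr c)
          by_cases h1 : η ∈ Set.Icc a b
          · have h2 : h + η ∈ Set.Icc a b := by
              constructor
              · by_contra hc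
                exact c1 ⟨by linarith [h1.1], by linarith⟩
              · by_contra hc
                exact c2 ⟨by linarith, by linarith [h1.2]⟩
            simp only [Set.indicator_of_mem h1]
            refine le_trans (ENNReal.ofReal_le_ofReal ?_) le_self_add
            have := E2_lip a b _ _ h2 h1
            rw [add_sub_cancel_right] at this
            rw [← sq_abs]
            have := abs_nonneg (E2 a b (h + η) - E2 a b η)
            nlinarith
          · have h2 : h + η ∉ Set.Icc a b := by
              intro h2
              rcases lt_or_ge η a with q | q
              · exact c1 ⟨by linarith [h2.1], by linarith⟩
              · have : b < η := by
                  by_contra hc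
                  exact h1 ⟨q, by linarith⟩
                exact c2 ⟨by linarith, by linarith [h2.2]⟩
            simp [E2_zero _ _ _ h1, E2_zero _ _ _ h2]
    _ = ENNReal.ofReal |h| * volume (Set.Icc a b) + volume B := by
        rw [lintegral_add_left (measurable_const.indicator measurableSet_Icc),
          lintegral_indicator_one hBm, lintegral_indicator_const measurableSet_Icc]
    _ ≤ ENNReal.ofReal |h| * ENNReal.ofReal (b - a) +
        (ENNReal.ofReal (2 * |h|) + ENNReal.ofReal (2 * |h|)) := by
        rw [Real.volume_Icc]
        gcongr
        refine (measure_union_le _ _).trans ?_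
        rw [Real.volume_Icc, Real.volume_Icc]
        apply le_of_eq
        congr 2 <;> ring
    _ ≤ _ := by
        rw [← ENNReal.ofReal_mul hh0, ← ENNReal.ofReal_add (by positivity) (by positivity),
          ← ENNReal.ofReal_add (mul_nonneg hh0 (by linarith)) (by positivity)]
        apply ENNReal.ofReal_le_ofReal
        nlinarith

lemma lint_abs (F : ℝ → ENNReal) :
    (∫⁻ h : ℝ, F |h|) ≤ 2 * ∫⁻ h in Set.Ioi 0, F h := by
  have e1 : (∫⁻ h in Set.Ioi (0:ℝ), F |h|) = ∫⁻ h in Set.Ioi (0:ℝ), F h :=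
    setLIntegral_congr_fun measurableSet_Ioi (fun x hx => by
      simp only [abs_of_pos (Set.mem_Ioi.1 hx)])
  have e2 : (∫⁻ h in Set.Iic (0:ℝ), F |h|) = ∫⁻ h in Set.Ioi (0:ℝ), F h := by
    rw [← e1, setLIntegral_congr Iio_ae_eq_Iic.symm]
    have := (Measure.measurePreserving_neg (volume : Measure ℝ)).setLIntegral_comp_preimage_emb
      (MeasurableEquiv.neg ℝ).measurableEmbedding (fun h => F |h|) (Set.Ioi 0)
    simpa using this
  rw [← lintegral_add_compl _ (measurableSet_Ioi (a := (0:ℝ))), Set.compl_Ioi, e1, e2, two_mul]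

/-- For `0 < σ < 1/2` and `ξ₁ ≤ ξ₂` with `ξ₂ - ξ₁ ≤ 1`, the Gagliardo seminorm of `E₂`
satisfies `∫_ℝ ∫_ℝ (E₂(ξ) - E₂(η))² / |ξ-η|^{1+2σ} dξ dη ≤ C(σ) (ξ₂-ξ₁)^{1-2σ}`. -/
theorem E2_gagliardo_bound (σ : ℝ) (hσ₁ : 0 < σ) (hσ₂ : σ < 1 / 2) :
    ∃ C : ℝ, 0 < C ∧ ∀ ξ₁ ξ₂ : ℝ, ξ₁ ≤ ξ₂ → ξ₂ - ξ₁ ≤ 1 →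
      (∫⁻ η : ℝ, ∫⁻ ξ : ℝ,
          ENNReal.ofReal ((E2 ξ₁ ξ₂ ξ - E2 ξ₁ ξ₂ η) ^ 2 / |ξ - η| ^ (1 + 2 * σ))) ≤
        ENNReal.ofReal (C * (ξ₂ - ξ₁) ^ (1 - 2 * σ)) := by
  have hs : 0 < 1 - 2 * σ := by linarith
  refine ⟨10 / (1 - 2 * σ) + 2 / σ, by positivity, ?_⟩
  intro a b hab hL1
  have hm := E2_meas a b
  have key : (∫⁻ η : ℝ, ∫⁻ ξ : ℝ,
      ENNReal.ofReal ((E2 a b ξ - E2 a b η) ^ 2 / |ξ - η| ^ (1 + 2 * σ))) =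
      ∫⁻ h : ℝ, ENNReal.ofReal (|h| ^ (-(1 + 2 * σ))) *
        ∫⁻ η : ℝ, ENNReal.ofReal ((E2 a b (h + η) - E2 a b η) ^ 2) := by
    calc _ = ∫⁻ η : ℝ, ∫⁻ h : ℝ, ENNReal.ofReal (|h| ^ (-(1 + 2 * σ))) *
              ENNReal.ofReal ((E2 a b (h + η) - E2 a b η) ^ 2) := by
          apply lintegral_congr
          intro η
          rw [← lintegral_add_right_eq_self _ η]
          apply lintegral_congr
          intro h
          rw [← ENNReal.ofReal_mul (by positivity), add_sub_cancel_right,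
            Real.rpow_neg (abs_nonneg h)]
          congr 1
          ring
      _ = ∫⁻ h : ℝ, ∫⁻ η : ℝ, ENNReal.ofReal (|h| ^ (-(1 + 2 * σ))) *
              ENNReal.ofReal ((E2 a b (h + η) - E2 a b η) ^ 2) := by
          apply lintegral_lintegral_swap
          apply Measurable.aemeasurable
          simp only [Function.uncurry_def]
          fun_prop
      _ = _ := by
          apply lintegral_congr
          intro h
          rw [lintegral_const_mul]
          fun_prop
  rw [key]
  rcases hab.eq_or_lt with rfl | hlt
  · have : ∀ h : ℝ, (∫⁻ η : ℝ, ENNReal.ofReal ((E2 a a (h + η) - E2 a a η) ^ 2)) = 0 := by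
      intro h
      have := g_le_L a a h le_rfl
      simpa using this
    simp [this]
  set L := b - a with hLdef
  have hL : 0 < L := by linarith
  let F : ℝ → ENNReal := fun h =>
    if h ≤ L then ENNReal.ofReal (5 * h ^ (-(2 * σ)))
    else ENNReal.ofReal (2 * L * h ^ (-(1 + 2 * σ)))
  have bd : ∀ᵐ h : ℝ, ENNReal.ofReal (|h| ^ (-(1 + 2 * σ))) *
        (∫⁻ η : ℝ, ENNReal.ofReal ((E2 a b (h + η) - E2 a b η) ^ 2)) ≤ F |h| := by
    have : ∀ᵐ h : ℝ, h ≠ 0 := by simp [ae_iff]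
    filter_upwards [this] with h h0
    have hp : 0 < |h| := abs_pos.2 h0
    simp only [F]
    split_ifs with hc
    · refine (mul_le_mul_right (g_le_h a b h hab hL1 hc) _).trans (le_of_eq ?_)
      rw [← ENNReal.ofReal_mul (by positivity)]
      congr 1
      have : |h| ^ (-(2 * σ)) = |h| ^ (-(1 + 2 * σ)) * |h| := by
        rw [← Real.rpow_add_one hp.ne']; congr 1; ring
      rw [this]; ring
    · refine (mul_le_mul_right (g_le_L a b h hab) _).trans (le_of_eq ?_)
      rw [← ENNReal.ofReal_mul (by positivity)]
      congr 1
      ring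
  refine (lintegral_mono_ae bd).trans ((lint_abs F).trans ?_)
  have s1 : (∫⁻ h in Set.Ioc 0 L, F h) = ENNReal.ofReal (5 * (L ^ (1 - 2 * σ) / (1 - 2 * σ))) := by
    rw [setLIntegral_congr_fun (g := fun h => ENNReal.ofReal (5 * h ^ (-(2 * σ)))) measurableSet_Ioc
      (fun x hx => by simp only [F, if_pos hx.2])]
    rw [← ofReal_integral_eq_lintegral_ofReal]
    · rw [integral_const_mul, ← intervalIntegral.integral_of_le hL.le,
        integral_rpow (Or.inl (by linarith)), Real.zero_rpow (by linarith)]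
      congr 3
      · rw [sub_zero]; congr 1; ring
      · ring
    · have := intervalIntegral.intervalIntegrable_rpow' (a := 0) (b := L) (r := -(2 * σ))
        (by linarith)
      exact ((intervalIntegrable_iff_integrableOn_Ioc_of_le hL.le).1 this).const_mul 5
    · filter_upwards [ae_restrict_mem measurableSet_Ioc] with x hx
      have := hx.1
      simp only [Pi.zero_apply]
      positivity
  have s2 : (∫⁻ h in Set.Ioi L, F h) = ENNReal.ofReal (L ^ (1 - 2 * σ) / σ) := by
    rw [setLIntegral_congr_fun (g := fun h => ENNReal.ofReal (2 * L * h ^ (-(1 + 2 * σ))))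
      measurableSet_Ioi
      (fun x hx => by simp only [F, if_neg (not_le.2 (Set.mem_Ioi.1 hx))])]
    rw [← ofReal_integral_eq_lintegral_ofReal]
    · rw [integral_const_mul, integral_Ioi_rpow_of_lt (by linarith) hL]
      congr 1
      have e : L ^ (1 - 2 * σ) = L ^ (-(1 + 2 * σ) + 1) * L := by
        rw [← Real.rpow_add_one hL.ne']; congr 1; ring
      rw [e]
      have : -(1 + 2 * σ) + 1 = -(2 * σ) := by ring
      rw [this]
      field_simp
    · exact (integrableOn_Ioi_rpow_of_lt (by linarith) hL).const_mul _
    · filter_upwards [ae_restrict_mem measurableSet_Ioi] with x hx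
      have : 0 < x := hL.trans hx
      simp only [Pi.zero_apply]
      positivity
  rw [← Set.Ioc_union_Ioi_eq_Ioi hL.le, lintegral_union measurableSet_Ioi
    (Set.Ioc_disjoint_Ioi le_rfl), s1, s2, ← ENNReal.ofReal_add (by positivity) (by positivity),
    show (2 : ENNReal) = ENNReal.ofReal 2 by simp, ← ENNReal.ofReal_mul (by norm_num)]
  apply ENNReal.ofReal_le_ofReal
  apply le_of_eq
  ring
end

section
/- Let 1/2 < s < 1, let f : ℝ → ℂ be a Schwartz function, and let ξ₁ ≤ ξ₂ be real numbers. Then there is a constant C(s) > 0 depending only on s such that |∫_ℝ E₁(ξ; ξ₁, ξ₂) f′(ξ) dξ| ≤ C(s) ‖f‖_{H^s(ℝ)} (ξ₂ − ξ₁). -/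
open MeasureTheory

/-- The fractional Sobolev norm `‖f‖_{H^s} = (2π ∫_ℝ (1+|k|²)^s |𝓕(f)(k)|² dk)^{1/2}`. -/
noncomputable def HsNorm (s : ℝ) (f : ℝ → ℂ) : ℝ :=
  Real.sqrt (2 * Real.pi * ∫ k : ℝ, (1 + |k| ^ 2) ^ s * ‖FT f k‖ ^ 2)

lemma FT_eq (f : SchwartzMap ℝ ℂ) (k : ℝ) :
    FT (fun x => f x) k = (1 / (2 * Real.pi) : ℂ) * (FourierTransform.fourier f) (k / (2 * Real.pi)) := by
  rw [SchwartzMap.fourier_coe, Real.fourier_real_eq_integral_exp_smul, FT]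
  congr 1
  apply integral_congr_ae
  filter_upwards with v
  rw [smul_eq_mul]
  congr 2
  have : (Real.pi : ℂ) ≠ 0 := by exact_mod_cast Real.pi_ne_zero
  push_cast
  field_simp

lemma schwartz_sup_bound (f : SchwartzMap ℝ ℂ) (x : ℝ) :
    ‖f x‖ ≤ ∫ k : ℝ, ‖FT (fun x => f x) k‖ := by
  have hpi := Real.pi_pos
  have h2 : (∫ k : ℝ, ‖FT (fun x => f x) k‖) = ∫ w : ℝ, ‖(FourierTransform.fourier f) w‖ := by
    have h := Measure.integral_comp_div (fun w : ℝ => ‖(FourierTransform.fourier f) w‖) (2 * Real.pi)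
    simp_rw [FT_eq, norm_mul]
    rw [integral_const_mul, h]
    have : ‖(1 / (2 * Real.pi) : ℂ)‖ = 1 / (2 * Real.pi) := by
      simp [abs_of_pos hpi]
    rw [this, abs_of_pos (by positivity), smul_eq_mul]
    field_simp
  rw [h2]
  have h3 : f x = FourierTransformInv.fourierInv (FourierTransform.fourier f) x := by simp
  rw [h3, SchwartzMap.fourierInv_coe, Real.fourierInv_eq]
  refine (norm_integral_le_integral_norm _).trans (le_of_eq ?_)
  simp

lemma FT_cs (s : ℝ) (hs₁ : 1 / 2 < s) (hs₂ : s < 1) (f : SchwartzMap ℝ ℂ) :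
    ∫ k : ℝ, ‖FT (fun x => f x) k‖ ≤
      Real.sqrt (∫ k : ℝ, (1 + |k| ^ 2) ^ (-s)) * HsNorm s (fun x => f x) := by
  have hpi := Real.pi_pos
  set F := FT (fun x => f x) with hF
  have hFe : F = fun k => (1 / (2 * Real.pi) : ℂ) * (FourierTransform.fourier f) (k / (2 * Real.pi)) :=
    funext (FT_eq f)
  have hcont : Continuous F := by
    rw [hFe]
    exact continuous_const.mul ((FourierTransform.fourier f).continuous.comp (by fun_prop))
  obtain ⟨M, hM⟩ : ∃ M, ∀ k, ‖F k‖ ≤ M := by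
    refine ⟨‖(1 / (2 * Real.pi) : ℂ)‖ * SchwartzMap.seminorm ℝ 0 0 (FourierTransform.fourier f), fun k => ?_⟩
    rw [hFe, norm_mul]
    gcongr
    exact SchwartzMap.norm_le_seminorm ℝ _ _
  have hI : Integrable (fun k => (1 + |k| ^ 2) * ‖F k‖) := by
    have h0 := (FourierTransform.fourier f).integrable_pow_mul volume 0
    have h2 := (FourierTransform.fourier f).integrable_pow_mul volume 2
    have h : Integrable (fun w : ℝ => ‖(1 / (2 * Real.pi) : ℂ)‖ * (‖w‖ ^ 0 * ‖(FourierTransform.fourier f) w‖ +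
      (2 * Real.pi) ^ 2 * (‖w‖ ^ 2 * ‖(FourierTransform.fourier f) w‖))) :=
      (h0.add (h2.const_mul _)).const_mul _
    have h' := h.comp_div (R := 2 * Real.pi) (by positivity)
    refine h'.congr (Filter.Eventually.of_forall fun k => ?_)
    simp only [hFe, norm_mul, norm_div, Real.norm_eq_abs, abs_of_pos hpi]
    simp only [Real.norm_eq_abs, sq_abs, abs_of_pos hpi, abs_two, div_pow]
    field_simp
  have hB : Integrable (fun k => (1 + |k| ^ 2) ^ s * ‖F k‖ ^ 2) := by
    refine (hI.const_mul M).mono' ?_ (Filter.Eventually.of_forall fun k => ?_)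
    · refine Continuous.aestronglyMeasurable (Continuous.mul ?_ (by fun_prop))
      exact Continuous.rpow_const (by fun_prop) (fun x => Or.inl (by positivity))
    · have h1 : (1 + |k| ^ 2) ^ s ≤ (1 + |k| ^ 2) := by
        apply Real.rpow_le_self_of_one_le _ hs₂.le
        have := sq_nonneg |k|; linarith
      rw [Real.norm_of_nonneg (by positivity)]
      calc (1 + |k| ^ 2) ^ s * ‖F k‖ ^ 2 ≤ (1 + |k| ^ 2) * (‖F k‖ * M) := by
            rw [sq ‖F k‖]
            gcongr
            exact hM k
        _ = _ := by ring
  have hA : Integrable (fun k : ℝ => (1 + |k| ^ 2) ^ (-s)) := by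
    have := integrable_rpow_neg_one_add_norm_sq (E := ℝ) (μ := volume) (r := 2 * s) (by simp; linarith)
    refine this.congr (Filter.Eventually.of_forall fun k => ?_)
    simp only [Real.norm_eq_abs]
    congr 1; ring
  have ea : ∀ k : ℝ, ((1 + |k| ^ 2) ^ (-s / 2)) ^ 2 = (1 + |k| ^ 2) ^ (-s) := fun k => by
    rw [← Real.rpow_natCast, ← Real.rpow_mul (by positivity)]; congr 1; push_cast; ring
  have eb : ∀ k : ℝ, ((1 + |k| ^ 2) ^ (s / 2) * ‖F k‖) ^ 2 = (1 + |k| ^ 2) ^ s * ‖F k‖ ^ 2 := fun k => by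
    rw [mul_pow, ← Real.rpow_natCast, ← Real.rpow_mul (by positivity)]; congr 2; push_cast; ring
  have ma : MemLp (fun k : ℝ => (1 + |k| ^ 2) ^ (-s / 2)) (ENNReal.ofReal 2) := by
    rw [show ENNReal.ofReal 2 = 2 by simp, memLp_two_iff_integrable_sq]
    · exact hA.congr (Filter.Eventually.of_forall fun k => (ea k).symm)
    · refine Continuous.aestronglyMeasurable ?_
      exact Continuous.rpow_const (by fun_prop) (fun x => Or.inl (by positivity))
  have mb : MemLp (fun k : ℝ => (1 + |k| ^ 2) ^ (s / 2) * ‖F k‖) (ENNReal.ofReal 2) := by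
    rw [show ENNReal.ofReal 2 = 2 by simp, memLp_two_iff_integrable_sq]
    · exact hB.congr (Filter.Eventually.of_forall fun k => (eb k).symm)
    · refine Continuous.aestronglyMeasurable (Continuous.mul ?_ (by fun_prop))
      exact Continuous.rpow_const (by fun_prop) (fun x => Or.inl (by positivity))
  have key := integral_mul_le_Lp_mul_Lq_of_nonneg (Real.HolderConjugate.two_two)
    (Filter.Eventually.of_forall fun k => by positivity)
    (Filter.Eventually.of_forall fun k => by positivity) ma mb
  have e0 : ∀ k : ℝ, (1 + |k| ^ 2) ^ (-s / 2) * ((1 + |k| ^ 2) ^ (s / 2) * ‖F k‖) = ‖F k‖ := fun k => by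
    rw [← mul_assoc, ← Real.rpow_add (by positivity)]
    simp [neg_div]
  simp only [e0, Real.rpow_two, ea, eb, ← Real.sqrt_eq_rpow] at key
  refine key.trans ?_
  unfold HsNorm
  have hnn : 0 ≤ ∫ k : ℝ, (1 + |k| ^ 2) ^ s * ‖F k‖ ^ 2 := integral_nonneg fun k => by positivity
  gcongr
  have := Real.pi_gt_three
  nlinarith

lemma ibp (f : SchwartzMap ℝ ℂ) (a M : ℝ) (hM : ∀ x, ‖f x‖ ≤ M) :
    ‖∫ ξ in Set.Iic a, (Real.exp (ξ - a) : ℂ) * deriv (fun x : ℝ => f x) ξ‖ ≤ 2 * M := by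
  have hd : ∀ x, HasDerivAt (fun x : ℝ => f x) (deriv (fun x : ℝ => f x) x) x := fun x =>
    f.differentiableAt.hasDerivAt
  have he : ∀ x, HasDerivAt (fun x : ℝ => (Real.exp (x - a) : ℂ)) (Real.exp (x - a) : ℂ) x := fun x => by
    have : HasDerivAt (fun x : ℝ => Real.exp (x - a)) (Real.exp (x - a)) x := by
      simpa using ((hasDerivAt_id x).sub_const a).exp
    exact this.ofReal_comp
  have hb : ∀ g : ℝ → ℂ, Integrable g → IntegrableOn (fun x : ℝ => (Real.exp (x - a) : ℂ) * g x) (Set.Iic a) := by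
    intro g hg
    refine hg.integrableOn.norm.mono' ?_ ?_
    · refine AEStronglyMeasurable.mul ?_ hg.integrableOn.aestronglyMeasurable
      exact Continuous.aestronglyMeasurable (by fun_prop)
    · refine (ae_restrict_mem measurableSet_Iic).mono fun x hx => ?_
      rw [norm_mul, Complex.norm_real, Real.norm_of_nonneg (Real.exp_pos _).le]
      have : Real.exp (x - a) ≤ 1 := Real.exp_le_one_iff.2 (sub_nonpos.2 hx)
      exact mul_le_of_le_one_left (norm_nonneg _) this
  have i1 := hb _ f.integrable
  have i2 := hb (deriv (fun x : ℝ => f x)) (SchwartzMap.derivCLM ℝ ℂ f).integrable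
  have eI : IntegrableOn (fun x : ℝ => Real.exp (x - a)) (Set.Iic a) := by
    simp_rw [Real.exp_sub]
    exact (integrableOn_exp_Iic a).div_const _
  have eV : ∫ x in Set.Iic a, Real.exp (x - a) = 1 := by
    simp_rw [Real.exp_sub]
    rw [integral_div, integral_exp_Iic, div_self (Real.exp_pos _).ne']
  have ht : Filter.Tendsto (fun x : ℝ => (Real.exp (x - a) : ℂ) * f x) Filter.atBot (nhds 0) := by
    have h1 : Filter.Tendsto (fun x : ℝ => Real.exp (x - a) * M) Filter.atBot (nhds 0) := by
      have : Filter.Tendsto (fun x : ℝ => Real.exp (x - a)) Filter.atBot (nhds 0) :=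
        Real.tendsto_exp_atBot.comp (Filter.tendsto_atBot_add_const_right _ (-a) Filter.tendsto_id)
      simpa using this.mul_const M
    refine squeeze_zero_norm (fun x => ?_) h1
    rw [norm_mul, Complex.norm_real, Real.norm_of_nonneg (Real.exp_pos _).le]
    gcongr
    exact hM x
  have key := integral_Iic_of_hasDerivAt_of_tendsto' (fun x _ => (he x).mul (hd x)) (i1.add i2) ht
  have hsum := integral_add i1 i2
  have hk : ∫ ξ in Set.Iic a, (Real.exp (ξ - a) : ℂ) * deriv (fun x : ℝ => f x) ξ
      = f a - ∫ ξ in Set.Iic a, (Real.exp (ξ - a) : ℂ) * f ξ := by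
    have h3 := hsum.symm.trans key
    rw [eq_sub_iff_add_eq, add_comm, h3]
    simp
  have hn : ‖∫ ξ in Set.Iic a, (Real.exp (ξ - a) : ℂ) * f ξ‖ ≤ M := by
    calc _ ≤ ∫ ξ in Set.Iic a, Real.exp (ξ - a) * M := by
          refine norm_integral_le_of_norm_le (eI.mul_const M) (Filter.Eventually.of_forall fun x => ?_)
          rw [norm_mul, Complex.norm_real, Real.norm_of_nonneg (Real.exp_pos _).le]
          gcongr
          exact hM x
      _ = M := by rw [integral_mul_const, eV, one_mul]
  rw [hk]
  refine (norm_sub_le _ _).trans ?_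
  linarith [hM a]

/-- For `1/2 < s < 1`, a Schwartz function `f` and `ξ₁ ≤ ξ₂`:
`|∫_ℝ E₁(ξ; ξ₁, ξ₂) f'(ξ) dξ| ≤ C(s) ‖f‖_{H^s} (ξ₂ - ξ₁)`. -/
theorem I1_bound (s : ℝ) (hs₁ : 1 / 2 < s) (hs₂ : s < 1) :
    ∃ C : ℝ, 0 < C ∧ ∀ f : SchwartzMap ℝ ℂ, ∀ ξ₁ ξ₂ : ℝ, ξ₁ ≤ ξ₂ →
      ‖∫ ξ : ℝ, (E1 ξ₁ ξ₂ ξ : ℂ) * deriv (fun x : ℝ => f x) ξ‖ ≤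
        C * HsNorm s (fun x => f x) * (ξ₂ - ξ₁) := by
  set A := Real.sqrt (∫ k : ℝ, (1 + |k| ^ 2) ^ (-s)) with hA
  have hA0 : 0 ≤ A := Real.sqrt_nonneg _
  refine ⟨2 * A + 1, by positivity, fun f a b hab => ?_⟩
  set N := HsNorm s (fun x => f x) with hN
  have hN0 : 0 ≤ N := Real.sqrt_nonneg _
  have hM : ∀ x, ‖f x‖ ≤ A * N := fun x => (schwartz_sup_bound f x).trans (FT_cs s hs₁ hs₂ f)
  have h1 := ibp f a _ hM
  have hE : (∫ ξ : ℝ, (E1 a b ξ : ℂ) * deriv (fun x : ℝ => f x) ξ) =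
      ((1 - Real.exp (a - b) : ℝ) : ℂ) *
        ∫ ξ in Set.Iic a, (Real.exp (ξ - a) : ℂ) * deriv (fun x : ℝ => f x) ξ := by
    rw [← integral_const_mul, ← integral_indicator measurableSet_Iic]
    congr 1
    funext ξ
    by_cases h : ξ ≤ a
    · rw [Set.indicator_of_mem (by exact h), E1, if_pos h, ← mul_assoc, ← Complex.ofReal_mul,
        sub_mul, ← Real.exp_add]
      congr 4
      · ring
      · ring
    · rw [Set.indicator_of_notMem (by exact h), E1, if_neg h]
      simp
  have hx : 1 - Real.exp (a - b) ≤ b - a := by linarith [Real.add_one_le_exp (a - b)]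
  have hx0 : 0 ≤ 1 - Real.exp (a - b) := sub_nonneg.2 (Real.exp_le_one_iff.2 (by linarith))
  rw [hE, norm_mul, Complex.norm_real, Real.norm_of_nonneg hx0]
  calc _ ≤ (b - a) * (2 * (A * N)) := by gcongr
    _ ≤ (2 * A + 1) * N * (b - a) := by nlinarith [mul_nonneg hN0 (sub_nonneg.2 hab)]
end

section
/- Let 1/2 < s < 1, let f : ℝ → ℂ be a Schwartz function, and let ξ₁ ≤ ξ₂ be real numbers with ξ₂ − ξ₁ ≤ 1. Set I = ∫_{−∞}^{ξ₁} e^{ξ−ξ₁} f′(ξ) dξ − ∫_{−∞}^{ξ₂} e^{ξ−ξ₂} f′(ξ) dξ. Then there is a constant C(s) > 0 depending only on s such that |f(ξ₁) − f(ξ₂)| ≤ C(s) ‖f‖_{H^s(ℝ)} (ξ₂ − ξ₁) + |I|. -/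
open MeasureTheory

lemma aux_parts (f : SchwartzMap ℝ ℂ) (a : ℝ) :
    (IntegrableOn (fun ξ : ℝ => (Real.exp (ξ - a) : ℂ) * f ξ) (Set.Iic a)) ∧
    (∫ ξ in Set.Iic a, (Real.exp (ξ - a) : ℂ) * deriv (fun x : ℝ => f x) ξ) =
      f a - ∫ ξ in Set.Iic a, (Real.exp (ξ - a) : ℂ) * f ξ := by
  have key : ∀ g : SchwartzMap ℝ ℂ,
      IntegrableOn (fun ξ : ℝ => (Real.exp (ξ - a) : ℂ) * g ξ) (Set.Iic a) := by
    intro g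
    refine Integrable.mono' (g.integrable.norm.integrableOn) ?_ ?_
    · refine Continuous.aestronglyMeasurable ?_
      have := g.continuous
      fun_prop
    · filter_upwards [ae_restrict_mem measurableSet_Iic] with x hx
      have hx' : x ≤ a := hx
      rw [norm_mul, Complex.norm_real, Real.norm_eq_abs, abs_of_pos (Real.exp_pos _)]
      have : Real.exp (x - a) ≤ 1 := Real.exp_le_one_iff.2 (by linarith)
      nlinarith [norm_nonneg (g x)]
  have h1 := key f
  have h2 : IntegrableOn (fun ξ : ℝ => (Real.exp (ξ - a) : ℂ) * deriv (fun x : ℝ => f x) ξ)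
      (Set.Iic a) := by
    have := key (SchwartzMap.derivCLM ℂ ℂ f)
    simpa [SchwartzMap.derivCLM_apply] using this
  refine ⟨h1, ?_⟩
  have h3 : ∀ x : ℝ, HasDerivAt (fun ξ : ℝ => (Real.exp (ξ - a) : ℂ) * f ξ)
      ((Real.exp (x - a) : ℂ) * f x + (Real.exp (x - a) : ℂ) * deriv (fun x : ℝ => f x) x) x := by
    intro x
    have e1 : HasDerivAt (fun ξ : ℝ => Real.exp (ξ - a)) (Real.exp (x - a)) x := by
      simpa using ((hasDerivAt_id x).sub_const a).exp
    have e2 : HasDerivAt (fun ξ : ℝ => (Real.exp (ξ - a) : ℂ)) (Real.exp (x - a) : ℂ) x :=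
      e1.ofReal_comp
    exact e2.mul (f.differentiableAt.hasDerivAt)
  have h4 : Filter.Tendsto (fun ξ : ℝ => (Real.exp (ξ - a) : ℂ) * f ξ) Filter.atBot (nhds 0) := by
    have t1 : Filter.Tendsto (fun ξ : ℝ => (Real.exp (ξ - a) : ℂ)) Filter.atBot (nhds 0) := by
      have : Filter.Tendsto (fun ξ : ℝ => Real.exp (ξ - a)) Filter.atBot (nhds 0) :=
        Real.tendsto_exp_atBot.comp (Filter.tendsto_atBot_add_const_right _ (-a) Filter.tendsto_id)
      have h := (Complex.continuous_ofReal.tendsto 0).comp this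
      simpa [Function.comp_def] using h
    have t2 : Filter.Tendsto (fun ξ : ℝ => f ξ) Filter.atBot (nhds 0) :=
      (zero_at_infty f).mono_left atBot_le_cocompact
    simpa using t1.mul t2
  have h5 := integral_Iic_of_hasDerivAt_of_tendsto' (fun x _ => h3 x) (h1.add h2) h4
  rw [integral_add h1 h2] at h5
  simp only [sub_self, Real.exp_zero, Complex.ofReal_one, one_mul, sub_zero] at h5
  rw [← h5]; ring

lemma aux_diff (f : SchwartzMap ℝ ℂ) (M : ℝ) (hM : ∀ x, ‖f x‖ ≤ M) (a b : ℝ) (hab : a ≤ b) :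
    ‖(∫ ξ in Set.Iic a, (Real.exp (ξ - a) : ℂ) * f ξ) -
      ∫ ξ in Set.Iic b, (Real.exp (ξ - b) : ℂ) * f ξ‖ ≤ 2 * M * (b - a) := by
  have hM0 : 0 ≤ M := (norm_nonneg _).trans (hM 0)
  have hb := (aux_parts f b).1
  have ha := (aux_parts f a).1
  have hu : Set.Iic b = Set.Iic a ∪ Set.Ioc a b := (Set.Iic_union_Ioc_eq_Iic hab).symm
  have hsp : ∫ ξ in Set.Iic b, (Real.exp (ξ - b) : ℂ) * f ξ =
      (Real.exp (a - b) : ℂ) * (∫ ξ in Set.Iic a, (Real.exp (ξ - a) : ℂ) * f ξ) +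
      ∫ ξ in Set.Ioc a b, (Real.exp (ξ - b) : ℂ) * f ξ := by
    rw [hu, setIntegral_union (Set.Iic_disjoint_Ioc le_rfl) measurableSet_Ioc
      (hb.mono_set (Set.Iic_subset_Iic.2 hab)) (hb.mono_set Set.Ioc_subset_Iic_self),
      ← integral_const_mul]
    congr 2
    ext x
    rw [← mul_assoc, ← Complex.ofReal_mul, ← Real.exp_add]
    congr 3; ring
  have hg : ‖∫ ξ in Set.Iic a, (Real.exp (ξ - a) : ℂ) * f ξ‖ ≤ M := by
    have i1 : IntegrableOn (fun x => Real.exp (x - a) * M) (Set.Iic a) := by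
      have := (integrableOn_exp_Iic a).mul_const (Real.exp (-a) * M)
      refine this.congr (Filter.Eventually.of_forall fun x => ?_)
      simp only [sub_eq_add_neg, Real.exp_add]; ring
    have := norm_integral_le_of_norm_le i1 (f := fun ξ : ℝ => (Real.exp (ξ - a) : ℂ) * f ξ)
      (Filter.Eventually.of_forall fun x => by
        rw [norm_mul, Complex.norm_real, Real.norm_eq_abs, abs_of_pos (Real.exp_pos _)]
        exact mul_le_mul_of_nonneg_left (hM x) (Real.exp_pos _).le)
    refine this.trans (le_of_eq ?_)
    have : ∀ x, Real.exp (x - a) * M = Real.exp x * (Real.exp (-a) * M) := by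
      intro x; simp only [sub_eq_add_neg, Real.exp_add]; ring
    simp_rw [this]
    rw [integral_mul_const, integral_exp_Iic, ← mul_assoc, ← Real.exp_add]
    simp
  have hh : ‖∫ ξ in Set.Ioc a b, (Real.exp (ξ - b) : ℂ) * f ξ‖ ≤ M * (b - a) := by
    have := norm_setIntegral_le_of_norm_le_const (μ := volume) (s := Set.Ioc a b) (C := M)
      (f := fun ξ : ℝ => (Real.exp (ξ - b) : ℂ) * f ξ) (by simp) (by
        intro x hx
        rw [norm_mul, Complex.norm_real, Real.norm_eq_abs, abs_of_pos (Real.exp_pos _)]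
        have : Real.exp (x - b) ≤ 1 := Real.exp_le_one_iff.2 (by linarith [hx.2])
        nlinarith [norm_nonneg (f x), hM x])
    simpa [measureReal_def, hab] using this
  rw [hsp]
  set g := ∫ ξ in Set.Iic a, (Real.exp (ξ - a) : ℂ) * f ξ
  set h := ∫ ξ in Set.Ioc a b, (Real.exp (ξ - b) : ℂ) * f ξ
  have e : g - ((Real.exp (a - b) : ℂ) * g + h) = ((1 - Real.exp (a - b) : ℝ) : ℂ) * g - h := by
    push_cast; ring
  rw [e]
  have hn : ‖((1 - Real.exp (a - b) : ℝ) : ℂ) * g‖ ≤ (b - a) * M := by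
    rw [norm_mul, Complex.norm_real, Real.norm_eq_abs, abs_of_nonneg
      (by have := Real.exp_le_one_iff.2 (show a - b ≤ 0 by linarith); linarith)]
    have := Real.add_one_le_exp (a - b)
    exact mul_le_mul (by linarith) hg (norm_nonneg _) (by linarith)
  have := norm_sub_le (((1 - Real.exp (a - b) : ℝ) : ℂ) * g) h
  linarith

open FourierTransform in
lemma aux_FT (f : SchwartzMap ℝ ℂ) (k : ℝ) :
    ‖FT (fun x => f x) k‖ = (2 * Real.pi)⁻¹ * ‖(𝓕 f : SchwartzMap ℝ ℂ) ((2 * Real.pi)⁻¹ * k)‖ := by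
  have hp := Real.pi_pos
  rw [FT, norm_mul, SchwartzMap.fourier_coe, Real.fourier_eq']
  congr 1
  · simp [abs_of_pos hp]
  · congr 2
    ext x
    rw [smul_eq_mul]
    congr 2
    simp only [RCLike.inner_apply, conj_trivial]
    push_cast
    have : (Real.pi : ℂ) ≠ 0 := by exact_mod_cast hp.ne'
    field_simp

open FourierTransform in
lemma aux_sup (f : SchwartzMap ℝ ℂ) :
    Integrable (fun k => ‖FT (fun x => f x) k‖) ∧
    (∀ x, ‖f x‖ ≤ ∫ k, ‖FT (fun x => f x) k‖) ∧
    ∃ C, ∀ k, (1 + |k| ^ 2) * ‖FT (fun x => f x) k‖ ≤ C := by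
  have hp := Real.pi_pos
  simp_rw [aux_FT]
  set h : SchwartzMap ℝ ℂ := 𝓕 f with hh
  refine ⟨?_, ?_, ?_⟩
  · exact (h.integrable.norm.comp_mul_left' (by positivity)).const_mul _
  · intro x
    rw [integral_const_mul, Measure.integral_comp_mul_left (fun k => ‖h k‖)]
    rw [inv_inv, abs_of_pos (by positivity), smul_eq_mul, inv_mul_cancel_left₀ (by positivity)]
    have : f x = (𝓕⁻ h : SchwartzMap ℝ ℂ) x := by simp [hh]
    rw [this, SchwartzMap.fourierInv_coe, Real.fourierInv_eq']
    refine (norm_integral_le_integral_norm _).trans (le_of_eq ?_)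
    congr 1
    ext v
    rw [norm_smul, Complex.norm_exp_ofReal_mul_I, one_mul]
  · obtain ⟨C0, -, h0⟩ := h.decay 0 0
    obtain ⟨C2, -, h2⟩ := h.decay 2 0
    refine ⟨(2 * Real.pi)⁻¹ * (C0 + (2 * Real.pi) ^ 2 * C2), fun k => ?_⟩
    set w := (2 * Real.pi)⁻¹ * k with hw
    have hk : k = (2 * Real.pi) * w := by rw [hw]; field_simp
    have a0 := h0 w
    have a2 := h2 w
    simp only [pow_zero, one_mul, norm_iteratedFDeriv_zero, Real.norm_eq_abs, sq_abs] at a0 a2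
    rw [sq_abs, hk]
    have : 0 < (2 * Real.pi) ^ 2 := by positivity
    calc _ = (2 * Real.pi)⁻¹ * (‖h w‖ + (2 * Real.pi) ^ 2 * (w ^ 2 * ‖h w‖)) := by ring
      _ ≤ _ := by gcongr

lemma aux_sobolev (s : ℝ) (hs₁ : 1 / 2 < s) (hs₂ : s < 1) (f : SchwartzMap ℝ ℂ) (x : ℝ) :
    ‖f x‖ ≤ Real.sqrt (∫ k : ℝ, (1 + |k| ^ 2) ^ (-s)) * HsNorm s (fun x => f x) := by
  obtain ⟨hi, hsup, C, hC⟩ := aux_sup f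
  refine (hsup x).trans ?_
  set G : ℝ → ℝ := fun k => ‖FT (fun x => f x) k‖ with hG
  have hG0 : ∀ k, 0 ≤ G k := fun k => norm_nonneg _
  change ∀ k, (1 + |k| ^ 2) * G k ≤ C at hC
  have hpos : ∀ k : ℝ, 0 < 1 + |k| ^ 2 := fun k => by positivity
  have hcont : ∀ r : ℝ, Continuous (fun k : ℝ => (1 + |k| ^ 2) ^ r) := fun r =>
    Continuous.rpow_const (by fun_prop) (fun k => Or.inl (hpos k).ne')
  have hA : Integrable (fun k : ℝ => (1 + |k| ^ 2) ^ (-s)) := by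
    have := integrable_rpow_neg_one_add_norm_sq (E := ℝ) (μ := volume) (r := 2 * s)
      (by simp; linarith)
    refine this.congr (Filter.Eventually.of_forall fun k => ?_)
    simp only [Real.norm_eq_abs]
    congr 1; ring
  have hB : Integrable (fun k : ℝ => (1 + |k| ^ 2) ^ s * G k ^ 2) := by
    refine Integrable.mono' (hi.const_mul C) ?_ (Filter.Eventually.of_forall fun k => ?_)
    · exact (hcont s).aestronglyMeasurable.mul (hi.aestronglyMeasurable.pow 2)
    · have h1 : (1 + |k| ^ 2) ^ s ≤ 1 + |k| ^ 2 := by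
        have := Real.rpow_le_rpow_of_exponent_le (x := 1 + |k| ^ 2)
          (by linarith [sq_nonneg |k|]) hs₂.le
        simpa using this
      rw [Real.norm_eq_abs, abs_of_nonneg (by have := hpos k; positivity)]
      calc _ ≤ (1 + |k| ^ 2) * G k ^ 2 := by gcongr
        _ = ((1 + |k| ^ 2) * G k) * G k := by ring
        _ ≤ C * G k := mul_le_mul_of_nonneg_right (hC k) (hG0 k)
  have eA : ∀ k : ℝ, ((1 + |k| ^ 2) ^ (-s / 2)) ^ 2 = (1 + |k| ^ 2) ^ (-s) := fun k => by
    rw [← Real.rpow_natCast, ← Real.rpow_mul (hpos k).le]; congr 1; push_cast; ring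
  have eB : ∀ k : ℝ, ((1 + |k| ^ 2) ^ (s / 2) * G k) ^ 2 = (1 + |k| ^ 2) ^ s * G k ^ 2 := fun k => by
    rw [mul_pow, ← Real.rpow_natCast, ← Real.rpow_mul (hpos k).le]; congr 2; push_cast; ring
  have mA : MemLp (fun k : ℝ => (1 + |k| ^ 2) ^ (-s / 2)) 2 :=
    (memLp_two_iff_integrable_sq (hcont _).aestronglyMeasurable).2 (by simp_rw [eA]; exact hA)
  have mB : MemLp (fun k : ℝ => (1 + |k| ^ 2) ^ (s / 2) * G k) 2 :=
    (memLp_two_iff_integrable_sq ((hcont _).aestronglyMeasurable.mul hi.aestronglyMeasurable)).2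
      (hB.congr (Filter.Eventually.of_forall fun k => (eB k).symm))
  have H := integral_mul_le_Lp_mul_Lq_of_nonneg (μ := volume) Real.HolderConjugate.two_two
    (f := fun k : ℝ => (1 + |k| ^ 2) ^ (-s / 2)) (g := fun k : ℝ => (1 + |k| ^ 2) ^ (s / 2) * G k)
    (Filter.Eventually.of_forall fun k => Real.rpow_nonneg (hpos k).le _)
    (Filter.Eventually.of_forall fun k => mul_nonneg (Real.rpow_nonneg (hpos k).le _) (hG0 k))
    (by simpa using mA) (by simpa using mB)
  have eP : ∀ k : ℝ, (1 + |k| ^ 2) ^ (-s / 2) * ((1 + |k| ^ 2) ^ (s / 2) * G k) = G k := fun k => by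
    rw [← mul_assoc, ← Real.rpow_add (hpos k)]
    have : -s / 2 + s / 2 = 0 := by ring
    rw [this, Real.rpow_zero, one_mul]
  simp only [Real.rpow_ofNat, eA, eB, eP, ← Real.sqrt_eq_rpow] at H
  refine H.trans ?_
  unfold HsNorm
  refine mul_le_mul_of_nonneg_left (Real.sqrt_le_sqrt ?_) (Real.sqrt_nonneg _)
  have h0 : 0 ≤ ∫ k : ℝ, (1 + |k| ^ 2) ^ s * G k ^ 2 :=
    integral_nonneg fun k => mul_nonneg (Real.rpow_nonneg (hpos k).le _) (sq_nonneg _)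
  exact le_mul_of_one_le_left h0 (by linarith [Real.pi_gt_three])

/-- For `1/2 < s < 1`, a Schwartz function `f` and `ξ₁ ≤ ξ₂` with `ξ₂ - ξ₁ ≤ 1`, setting
`I = ∫_{-∞}^{ξ₁} e^{ξ-ξ₁} f'(ξ) dξ - ∫_{-∞}^{ξ₂} e^{ξ-ξ₂} f'(ξ) dξ`, one has
`|f(ξ₁) - f(ξ₂)| ≤ C(s) ‖f‖_{H^s} (ξ₂ - ξ₁) + |I|`. -/
theorem f_diff_bound (s : ℝ) (hs₁ : 1 / 2 < s) (hs₂ : s < 1) :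
    ∃ C : ℝ, 0 < C ∧ ∀ f : SchwartzMap ℝ ℂ, ∀ ξ₁ ξ₂ : ℝ, ξ₁ ≤ ξ₂ → ξ₂ - ξ₁ ≤ 1 →
      ‖f ξ₁ - f ξ₂‖ ≤ C * HsNorm s (fun x => f x) * (ξ₂ - ξ₁) +
        ‖(∫ ξ in Set.Iic ξ₁, (Real.exp (ξ - ξ₁) : ℂ) * deriv (fun x : ℝ => f x) ξ) -
          ∫ ξ in Set.Iic ξ₂, (Real.exp (ξ - ξ₂) : ℂ) * deriv (fun x : ℝ => f x) ξ‖ := by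
  refine ⟨2 * Real.sqrt (∫ k : ℝ, (1 + |k| ^ 2) ^ (-s)) + 1, by positivity, ?_⟩
  intro f a b hab _
  have hd := aux_diff f _ (aux_sobolev s hs₁ hs₂ f) a b hab
  rw [(aux_parts f a).2, (aux_parts f b).2]
  have hN : 0 ≤ HsNorm s (fun x => f x) := Real.sqrt_nonneg _
  set N := HsNorm s (fun x => f x)
  set ga := ∫ ξ in Set.Iic a, (Real.exp (ξ - a) : ℂ) * f ξ
  set gb := ∫ ξ in Set.Iic b, (Real.exp (ξ - b) : ℂ) * f ξ
  have e : f a - f b = (ga - gb) + (f a - ga - (f b - gb)) := by ring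
  have h1 : ‖f a - f b‖ ≤ ‖ga - gb‖ + ‖f a - ga - (f b - gb)‖ := by
    conv_lhs => rw [e]
    exact norm_add_le _ _
  have h2 : 0 ≤ N * (b - a) := mul_nonneg hN (by linarith)
  linarith
end
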